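/- arXiv:1006.2416 — 2 statements merged into one kernel-verified Lean document; each statement's English description precedes it below -/
import Mathlib

section
/- Let p ≥ 2, let u : Fin p → ℝ and v : Fin 2 → ℝ have all entries strictly positive with ∑_i u i = ∑_j v j, and let P = T(u,v) be the resulting p×2 classical transportation polytope. Let d be the dimension of P and n the number of facets of P. Then any two extreme points of P are joined by a path in the graph G(P) of length at most n − d (the Hirsch Conjecture holds for p×2 classical transportation polytopes). -/
open scoped BigOperators

noncomputable section

/-- The classical `p × q` transportation polytope with marginals `u` and `v`. -/
def transportationPolytope {p q : ℕ} (u : Fin p → ℝ) (v : Fin q → ℝ) :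
    Set (Fin p → Fin q → ℝ) :=
  {x | (∀ i j, 0 ≤ x i j) ∧ (∀ i, ∑ j, x i j = u i) ∧ (∀ j, ∑ i, x i j = v j)}

/-- Adjacency in the graph of a convex set `P`: two distinct extreme points whose closed
segment is a face of `P`. -/
def PolyAdj {E : Type*} [AddCommGroup E] [Module ℝ E] (P : Set E) (a b : E) : Prop :=
  a ≠ b ∧ a ∈ Set.extremePoints ℝ P ∧ b ∈ Set.extremePoints ℝ P ∧
    IsExtreme ℝ P (segment ℝ a b)

/-- A path of length `L` in the graph of `P` from `a` to `b`. -/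
def HasPathOfLength {E : Type*} [AddCommGroup E] [Module ℝ E] (P : Set E) (a b : E)
    (L : ℕ) : Prop :=
  ∃ f : ℕ → E, f 0 = a ∧ f L = b ∧ ∀ i < L, PolyAdj P (f i) (f (i + 1))

/-- A face of a convex set `P`: a convex extreme subset. -/
def IsFace {E : Type*} [AddCommGroup E] [Module ℝ E] (P F : Set E) : Prop :=
  Convex ℝ F ∧ IsExtreme ℝ P F

/-- The dimension of a set: the rank of the direction of its affine span. -/
noncomputable def setDim {E : Type*} [AddCommGroup E] [Module ℝ E] (S : Set E) : ℕ :=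
  Module.finrank ℝ (affineSpan ℝ S).direction

/-- A facet of `P` is a face of dimension `dim P - 1`. -/
def IsFacet {E : Type*} [AddCommGroup E] [Module ℝ E] (P F : Set E) : Prop :=
  IsFace P F ∧ setDim F = setDim P - 1

/-- The number of facets of `P`. -/
noncomputable def numFacets {E : Type*} [AddCommGroup E] [Module ℝ E] (P : Set E) : ℕ :=
  Set.ncard {F : Set E | IsFacet P F}


section

variable {p : ℕ} {u : Fin p → ℝ} {v : Fin 2 → ℝ}

lemma sum_fin_two_of_ne {e e' : Fin 2} (h : e ≠ e') (f : Fin 2 → ℝ) :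
    ∑ j, f j = f e + f e' := by
  fin_cases e <;> fin_cases e' <;> simp_all [Fin.sum_univ_two, add_comm]

lemma forall_fin_two_of_ne {e e' : Fin 2} (h : e ≠ e') {Q : Fin 2 → Prop} :
    (∀ j, Q j) ↔ Q e ∧ Q e' := by
  fin_cases e <;> fin_cases e' <;> simp_all [Fin.forall_fin_two, and_comm]

lemma exists_fin_two_of_ne {e e' : Fin 2} (h : e ≠ e') {Q : Fin 2 → Prop} :
    (∃ j, Q j) ↔ Q e ∨ Q e' := by
  fin_cases e <;> fin_cases e' <;> simp_all [Fin.exists_fin_two, or_comm]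

/-- Membership in a `p × 2` transportation polytope, checked on the column sum of one column. -/
lemma mem_transportationPolytope_iff (hsum : ∑ i, u i = ∑ j, v j) {e e' : Fin 2} (h : e ≠ e')
    {x : Fin p → Fin 2 → ℝ} :
    x ∈ transportationPolytope u v ↔
      (∀ i, 0 ≤ x i e ∧ 0 ≤ x i e' ∧ x i e + x i e' = u i) ∧ ∑ i, x i e = v e := by
  simp only [transportationPolytope, Set.mem_ofPred_eq, forall_fin_two_of_ne h,
    sum_fin_two_of_ne h]
  rw [sum_fin_two_of_ne h] at hsum
  constructor
  · rintro ⟨h1, h2, h3, -⟩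
    exact ⟨fun i => ⟨(h1 i).1, (h1 i).2, h2 i⟩, h3⟩
  · rintro ⟨h1, h2⟩
    refine ⟨fun i => ⟨(h1 i).1, (h1 i).2.1⟩, fun i => (h1 i).2.2, h2, ?_⟩
    have : ∑ i, (x i e + x i e') = ∑ i, u i := Finset.sum_congr rfl fun i _ => (h1 i).2.2
    rw [Finset.sum_add_distrib] at this
    linarith

lemma convex_transportationPolytope : Convex ℝ (transportationPolytope u v) := by
  rintro x ⟨hx, hx1, hx2⟩ y ⟨hy, hy1, hy2⟩ s t hs ht hst
  refine ⟨fun i j => ?_, fun i => ?_, fun j => ?_⟩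
  · have := mul_nonneg hs (hx i j)
    have := mul_nonneg ht (hy i j)
    simp only [Pi.add_apply, Pi.smul_apply, smul_eq_mul]
    positivity
  · simp only [Pi.add_apply, Pi.smul_apply, smul_eq_mul, Finset.sum_add_distrib,
      ← Finset.mul_sum, hx1, hy1, ← add_mul, hst, one_mul]
  · simp only [Pi.add_apply, Pi.smul_apply, smul_eq_mul, Finset.sum_add_distrib,
      ← Finset.mul_sum, hx2, hy2, ← add_mul, hst, one_mul]

lemma eq_zero_of_mem_openSegment {x y z : Fin p → Fin 2 → ℝ}
    (hx : x ∈ transportationPolytope u v) (hy : y ∈ transportationPolytope u v)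
    (hz : z ∈ openSegment ℝ x y) {i : Fin p} {j : Fin 2} (h : z i j = 0) : x i j = 0 := by
  obtain ⟨s, t, hs, ht, -, rfl⟩ := hz
  simp only [Pi.add_apply, Pi.smul_apply, smul_eq_mul] at h
  have h1 := mul_nonneg hs.le (hx.1 i j)
  have h2 := mul_nonneg ht.le (hy.1 i j)
  have h3 : s * x i j = 0 := by linarith
  simpa [hs.ne'] using h3

/-- Two points of the polytope sharing a zero in some row agree on that row. -/
lemma row_eq_of_zero {x y : Fin p → Fin 2 → ℝ} (hx : x ∈ transportationPolytope u v)
    (hy : y ∈ transportationPolytope u v) {i : Fin p} {j : Fin 2}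
    (h : x i j = 0) (h' : y i j = 0) : x i = y i := by
  obtain ⟨j', hj⟩ := exists_ne j
  have h1 := hx.2.1 i
  have h2 := hy.2.1 i
  rw [sum_fin_two_of_ne hj.symm] at h1 h2
  funext f
  revert f
  rw [forall_fin_two_of_ne hj.symm]
  constructor <;> linarith

/-- Two points of the polytope which agree outside of one row are equal. -/
lemma eq_of_rows_eq {x y : Fin p → Fin 2 → ℝ} (hx : x ∈ transportationPolytope u v)
    (hy : y ∈ transportationPolytope u v) {k : Fin p} (h : ∀ i ≠ k, x i = y i) : x = y := by
  funext i
  by_cases hi : i = k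
  · subst hi
    funext j
    have h1 := hx.2.2 j
    rw [← hy.2.2 j, ← Finset.add_sum_erase _ _ (Finset.mem_univ i),
      ← Finset.add_sum_erase (a := i) _ (fun i => y i j) (Finset.mem_univ i),
      Finset.sum_congr rfl fun l hl => congrFun (h l (Finset.ne_of_mem_erase hl)) j] at h1
    linarith
  · exact h i hi

/-- A point of the polytope whose rows, with the possible exception of row `k`, all have a zero. -/
def IsBasicAt (u : Fin p → ℝ) (v : Fin 2 → ℝ) (x : Fin p → Fin 2 → ℝ) (k : Fin p) : Prop :=
  x ∈ transportationPolytope u v ∧ ∀ i ≠ k, ∃ j, x i j = 0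

lemma IsBasicAt.mem_extremePoints {x : Fin p → Fin 2 → ℝ} {k : Fin p}
    (hx : IsBasicAt u v x k) : x ∈ Set.extremePoints ℝ (transportationPolytope u v) := by
  refine ⟨hx.1, fun y hy z hz hyz => ?_⟩
  refine eq_of_rows_eq hy hx.1 (k := k) fun i hi => ?_
  obtain ⟨j, hj⟩ := hx.2 i hi
  exact row_eq_of_zero hy hx.1 (eq_zero_of_mem_openSegment hy hz hyz hj) hj

/-- Move `t` units in column `e` from row `j` to row `k`, and back in the other column. -/
def exchange (e : Fin 2) (k j : Fin p) (t : ℝ) (x : Fin p → Fin 2 → ℝ) : Fin p → Fin 2 → ℝ :=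
  fun i f => x i f +
    (if f = e then t else -t) * ((if i = k then 1 else 0) - (if i = j then 1 else 0))

lemma exchange_of_ne {e : Fin 2} {k j i : Fin p} (t : ℝ) (x : Fin p → Fin 2 → ℝ)
    (hk : i ≠ k) (hj : i ≠ j) : exchange e k j t x i = x i := by
  funext f
  simp [exchange, hk, hj]

lemma exchange_mem (hsum : ∑ i, u i = ∑ j, v j) {e e' : Fin 2} (h : e ≠ e') {k j : Fin p}
    (hkj : k ≠ j) {t : ℝ} {x : Fin p → Fin 2 → ℝ} (hx : x ∈ transportationPolytope u v)
    (h1 : 0 ≤ x k e + t) (h2 : 0 ≤ x k e' - t) (h3 : 0 ≤ x j e - t) (h4 : 0 ≤ x j e' + t) :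
    exchange e k j t x ∈ transportationPolytope u v := by
  rw [mem_transportationPolytope_iff hsum h] at hx ⊢
  constructor
  · intro i
    by_cases hk : i = k
    · subst hk
      have := hx.1 i
      simp only [exchange, if_true, if_neg h.symm, if_neg hkj]
      refine ⟨?_, ?_, ?_⟩ <;> linarith
    by_cases hj : i = j
    · subst hj
      have := hx.1 i
      simp only [exchange, if_true, if_neg h.symm, if_neg hkj.symm]
      refine ⟨?_, ?_, ?_⟩ <;> linarith
    · rw [exchange_of_ne t x hk hj]
      exact hx.1 i
  · simp [exchange, Finset.sum_add_distrib, ← Finset.mul_sum, hx.2]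

lemma exists_isBasicAt (hp : 0 < p) (hsum : ∑ i, u i = ∑ j, v j) {x : Fin p → Fin 2 → ℝ}
    (hx : x ∈ Set.extremePoints ℝ (transportationPolytope u v)) : ∃ k, IsBasicAt u v x k := by
  by_contra! hcon
  simp only [IsBasicAt, not_and, not_forall, not_exists] at hcon
  obtain ⟨k, -, hk⟩ := hcon ⟨0, hp⟩ hx.1
  obtain ⟨j, hjk, hj⟩ := hcon k hx.1
  have hpos : ∀ i, (∀ f, ¬ x i f = 0) → ∀ f, 0 < x i f :=
    fun i hi f => lt_of_le_of_ne (hx.1.1 i f) (Ne.symm (hi f))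
  have hk := hpos k hk
  have hj := hpos j hj
  obtain ⟨t, ht, ht'⟩ : ∃ t > 0, t < min (min (x k 0) (x k 1)) (min (x j 0) (x j 1)) :=
    exists_between (by simp [hk, hj])
  simp only [lt_min_iff] at ht'
  have e01 : (0 : Fin 2) ≠ 1 := by decide
  have hy := exchange_mem hsum e01 hjk.symm (t := t) hx.1
    (by linarith) (by linarith) (by linarith) (by linarith)
  have hz := exchange_mem hsum e01 hjk.symm (t := -t) hx.1
    (by linarith) (by linarith) (by linarith) (by linarith)
  have := hx.2 hy hz ⟨1 / 2, 1 / 2, by norm_num, by norm_num, by norm_num, by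
    funext i f
    simp only [exchange, Pi.add_apply, Pi.smul_apply, smul_eq_mul]
    split_ifs <;> ring⟩
  have := congrFun (congrFun this k) 0
  simp [exchange, hjk.symm] at this
  linarith

lemma polyAdj_of_rows_eq {x y : Fin p → Fin 2 → ℝ}
    (hx : x ∈ Set.extremePoints ℝ (transportationPolytope u v))
    (hy : y ∈ Set.extremePoints ℝ (transportationPolytope u v)) (hxy : x ≠ y) {k j : Fin p}
    (h : ∀ i, i ≠ k → i ≠ j → x i = y i ∧ ∃ f, x i f = 0) :
    PolyAdj (transportationPolytope u v) x y := by
  refine ⟨hxy, hx, hy, convex_transportationPolytope.segment_subset hx.1 hy.1, ?_⟩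
  intro z hz w hw m hm hmzw
  have hmP := convex_transportationPolytope.segment_subset hx.1 hy.1 hm
  have hrow : ∀ i, i ≠ k → i ≠ j → z i = x i := by
    intro i hk hj
    obtain ⟨hxyi, f, hf⟩ := h i hk hj
    have hmf : m i f = 0 := by
      obtain ⟨s, t, -, -, -, rfl⟩ := hm
      simp [← hxyi, hf]
    exact row_eq_of_zero hz hx.1 (eq_zero_of_mem_openSegment hz hw hmzw hmf) hf
  have hne : x k 0 ≠ y k 0 := by
    intro h0
    refine hxy (eq_of_rows_eq hx.1 hy.1 (k := j) fun i hi => ?_)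
    by_cases hk : i = k
    · subst hk
      have h1 := hx.1.2.1 i
      have h2 := hy.1.2.1 i
      rw [Fin.sum_univ_two] at h1 h2
      funext f
      fin_cases f <;> simp <;> linarith
    · exact (h i hk hi).1
  set t : ℝ := (z k 0 - x k 0) / (y k 0 - x k 0) with ht
  have hzt : z = (1 - t) • x + t • y := by
    have htk : z k 0 = x k 0 + t * (y k 0 - x k 0) := by
      rw [ht, div_mul_cancel₀ _ (sub_ne_zero.2 hne.symm)]
      ring
    have hk : z k = ((1 - t) • x + t • y) k := by
      have h1 := hx.1.2.1 k
      have h2 := hy.1.2.1 k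
      have h3 := hz.2.1 k
      rw [Fin.sum_univ_two] at h1 h2 h3
      funext f
      fin_cases f
      · simp; linarith
      · have e1 : x k 1 = u k - x k 0 := by linarith
        have e2 : y k 1 = u k - y k 0 := by linarith
        have e3 : z k 1 = u k - z k 0 := by linarith
        simp [e1, e2, e3]; linarith
    have hoth : ∀ i ≠ j, z i = ((1 - t) • x + t • y) i := by
      intro i hi
      by_cases hik : i = k
      · rw [hik, hk]
      · rw [hrow i hik hi]
        simp only [Pi.add_apply, Pi.smul_apply, ← (h i hik hi).1, ← add_smul]
        simp
    funext i
    by_cases hi : i = j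
    · subst hi
      funext f
      have h1 := hx.1.2.2 f
      have h2 := hy.1.2.2 f
      have h3 := hz.2.2 f
      rw [← Finset.add_sum_erase _ _ (Finset.mem_univ i)] at h1 h2 h3
      rw [Finset.sum_congr rfl fun l hl => congrFun (hoth l (Finset.ne_of_mem_erase hl)) f] at h3
      simp only [Pi.add_apply, Pi.smul_apply, smul_eq_mul, Finset.sum_add_distrib,
        ← Finset.mul_sum] at h3 ⊢
      linear_combination h3 - (1 - t) * h1 - t * h2
    · exact hoth i hi
  have key : ∀ {s : ℝ} {x y : Fin p → Fin 2 → ℝ},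
      x ∈ transportationPolytope u v → y ∈ Set.extremePoints ℝ (transportationPolytope u v) →
      x ≠ y → z = (1 - s) • x + s • y → s ≤ 1 := by
    intro s x y hx hy hxy hzs
    by_contra! hs
    refine hxy (hy.2 hx hz ⟨1 - s⁻¹, s⁻¹, ?_, by positivity, by ring, ?_⟩)
    · have := inv_lt_one_of_one_lt₀ hs
      linarith
    · have hs0 : s ≠ 0 := by positivity
      rw [hzs]
      funext i f
      simp only [Pi.add_apply, Pi.smul_apply, smul_eq_mul]
      field_simp
      ring
  have h1 : t ≤ 1 := key hx.1 hy hxy hzt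
  have h0 : 1 - t ≤ 1 := key hy.1 hx hxy.symm (by rw [hzt, sub_sub_cancel, add_comm])
  exact ⟨1 - t, t, by linarith, by linarith, by ring, hzt.symm⟩

/-- The set of points of the polytope vanishing at all the entries in `Z`. -/
def faceOn (u : Fin p → ℝ) (v : Fin 2 → ℝ) (Z : Set (Fin p × Fin 2)) :
    Set (Fin p → Fin 2 → ℝ) :=
  {x ∈ transportationPolytope u v | ∀ q ∈ Z, x q.1 q.2 = 0}

/-- The matrices with vanishing row and column sums which vanish at all the entries in `Z`. -/
def dirOn (Z : Set (Fin p × Fin 2)) : Submodule ℝ (Fin p → Fin 2 → ℝ) where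
  carrier := {w | (∀ i, ∑ j, w i j = 0) ∧ (∀ j, ∑ i, w i j = 0) ∧ ∀ q ∈ Z, w q.1 q.2 = 0}
  add_mem' := by
    rintro x y ⟨hx1, hx2, hx3⟩ ⟨hy1, hy2, hy3⟩
    refine ⟨fun i => ?_, fun j => ?_, fun q hq => ?_⟩
    · simp only [Pi.add_apply, Finset.sum_add_distrib, hx1, hy1, add_zero]
    · simp only [Pi.add_apply, Finset.sum_add_distrib, hx2, hy2, add_zero]
    · simp [hx3 q hq, hy3 q hq]
  zero_mem' := by simp
  smul_mem' := by
    rintro c x ⟨hx1, hx2, hx3⟩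
    refine ⟨fun i => ?_, fun j => ?_, fun q hq => ?_⟩
    · simp only [Pi.smul_apply, smul_eq_mul, ← Finset.mul_sum, hx1, mul_zero]
    · simp only [Pi.smul_apply, smul_eq_mul, ← Finset.mul_sum, hx2, mul_zero]
    · simp [hx3 q hq]

lemma exists_pos_add_smul_mem {x w : Fin p → Fin 2 → ℝ} {Z : Set (Fin p × Fin 2)}
    (hx : x ∈ faceOn u v Z) (hw : w ∈ dirOn Z) (h : ∀ q ∉ Z, x q.1 q.2 ≠ 0) :
    ∃ t > (0 : ℝ), x + t • w ∈ faceOn u v Z := by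
  have key : ∀ᶠ t in nhdsWithin (0 : ℝ) (Set.Ioi 0),
      ∀ q : Fin p × Fin 2, 0 ≤ x q.1 q.2 + t * w q.1 q.2 := by
    rw [Filter.eventually_all]
    intro q
    by_cases hq : q ∈ Z
    · simp [hx.2 q hq, hw.2.2 q hq]
    · have hpos : 0 < x q.1 q.2 := lt_of_le_of_ne (hx.1.1 _ _) (Ne.symm (h q hq))
      have hcont : Filter.Tendsto (fun t : ℝ => x q.1 q.2 + t * w q.1 q.2)
          (nhdsWithin (0 : ℝ) (Set.Ioi 0)) (nhds (x q.1 q.2 + 0 * w q.1 q.2)) :=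
        Filter.Tendsto.mono_left (Continuous.tendsto (by fun_prop) 0) nhdsWithin_le_nhds
      filter_upwards [hcont.eventually_const_lt (u := 0) (by simpa using hpos)] with t ht
      exact ht.le
  obtain ⟨t, ht, ht0⟩ := (key.and self_mem_nhdsWithin).exists
  refine ⟨t, ht0, ⟨fun i j => ht (i, j), fun i => ?_, fun j => ?_⟩, fun q hq => ?_⟩
  · simp only [Pi.add_apply, Pi.smul_apply, smul_eq_mul, Finset.sum_add_distrib,
      ← Finset.mul_sum, hw.1, hx.1.2.1, mul_zero, add_zero]
  · simp only [Pi.add_apply, Pi.smul_apply, smul_eq_mul, Finset.sum_add_distrib,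
      ← Finset.mul_sum, hw.2.1, hx.1.2.2, mul_zero, add_zero]
  · simp [hx.2 q hq, hw.2.2 q hq]

lemma sub_mem_dirOn {x y : Fin p → Fin 2 → ℝ} {Z : Set (Fin p × Fin 2)}
    (hx : x ∈ faceOn u v Z) (hy : y ∈ faceOn u v Z) : x - y ∈ dirOn Z := by
  refine ⟨fun i => ?_, fun j => ?_, fun q hq => ?_⟩
  · simp only [Pi.sub_apply, Finset.sum_sub_distrib, hx.1.2.1, hy.1.2.1, sub_self]
  · simp only [Pi.sub_apply, Finset.sum_sub_distrib, hx.1.2.2, hy.1.2.2, sub_self]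
  · simp [hx.2 q hq, hy.2 q hq]

lemma setDim_faceOn {x : Fin p → Fin 2 → ℝ} {Z : Set (Fin p × Fin 2)}
    (hx : x ∈ faceOn u v Z) (h : ∀ q ∉ Z, x q.1 q.2 ≠ 0) :
    setDim (faceOn u v Z) = Module.finrank ℝ (dirOn Z) := by
  have : (affineSpan ℝ (faceOn u v Z)).direction = dirOn Z := by
    rw [direction_affineSpan]
    apply le_antisymm
    · rw [vectorSpan_def, Submodule.span_le]
      rintro _ ⟨y, hy, z, hz, rfl⟩
      exact sub_mem_dirOn hy hz
    · intro w hw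
      obtain ⟨t, ht, hmem⟩ := exists_pos_add_smul_mem hx hw h
      have := vsub_mem_vectorSpan ℝ hmem hx
      rw [vsub_eq_sub, add_sub_cancel_left] at this
      exact (Submodule.smul_mem_iff _ ht.ne').1 this
  rw [setDim, this]

lemma isFace_faceOn (Z : Set (Fin p × Fin 2)) :
    IsFace (transportationPolytope u v) (faceOn u v Z) := by
  refine ⟨?_, fun x hx => hx.1, fun x hx y hy z hz hxy => ?_⟩
  · intro x hx y hy s t hs ht hst
    refine ⟨convex_transportationPolytope hx.1 hy.1 hs ht hst, fun q hq => ?_⟩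
    simp [hx.2 q hq, hy.2 q hq]
  · exact ⟨hx, fun q hq => eq_zero_of_mem_openSegment hx hy hxy (hz.2 q hq)⟩

/-- A nonempty convex set of nonnegative matrices has a point with the largest support. -/
lemma exists_mem_max_support {F : Set (Fin p → Fin 2 → ℝ)} (hF : Convex ℝ F)
    (hne : F.Nonempty) (hnn : ∀ x ∈ F, ∀ i j, 0 ≤ x i j) :
    ∃ x ∈ F, ∀ y ∈ F, ∀ i j, x i j = 0 → y i j = 0 := by
  classical
  let g : (Fin p → Fin 2 → ℝ) → ℕ := fun x =>
    (Finset.univ.filter fun q : Fin p × Fin 2 => x q.1 q.2 = 0).card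
  obtain ⟨x, hx, hmin⟩ : ∃ x ∈ F, ∀ y ∈ F, g x ≤ g y :=
    ⟨_, Function.argminOn_mem g F hne, fun y hy => Function.argminOn_le g F hy⟩
  refine ⟨x, hx, fun y hy i j hij => ?_⟩
  have hz := hF hx hy (by norm_num : (0 : ℝ) ≤ 1 / 2) (by norm_num : (0 : ℝ) ≤ 1 / 2)
    (by norm_num)
  set z := (1 / 2 : ℝ) • x + (1 / 2 : ℝ) • y with hzdef
  have hzval : ∀ i j, z i j = 1 / 2 * x i j + 1 / 2 * y i j := fun i j => by simp [hzdef]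
  have hsub : (Finset.univ.filter fun q : Fin p × Fin 2 => z q.1 q.2 = 0) ⊆
      Finset.univ.filter fun q : Fin p × Fin 2 => x q.1 q.2 = 0 := by
    intro q hq
    simp only [Finset.mem_filter, Finset.mem_univ, true_and, hzval] at hq ⊢
    have := hnn x hx q.1 q.2
    have := hnn y hy q.1 q.2
    linarith
  have heq := Finset.eq_of_subset_of_card_le hsub (hmin z hz)
  have : (i, j) ∈ Finset.univ.filter fun q : Fin p × Fin 2 => z q.1 q.2 = 0 := by
    rw [heq]
    simpa using hij
  simp only [Finset.mem_filter, Finset.mem_univ, true_and, hzval, hij] at this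
  linarith

lemma IsFace.eq_faceOn {F : Set (Fin p → Fin 2 → ℝ)}
    (hF : IsFace (transportationPolytope u v) F) (hne : F.Nonempty) :
    ∃ Z, F = faceOn u v Z := by
  obtain ⟨x, hx, hmax⟩ := exists_mem_max_support hF.1 hne fun y hy => (hF.2.1 hy).1
  refine ⟨{q | x q.1 q.2 = 0}, Set.Subset.antisymm
    (fun y hy => ⟨hF.2.1 hy, fun q hq => hmax y hy _ _ hq⟩) fun y hy => ?_⟩
  have hxf : x ∈ faceOn u v {q | x q.1 q.2 = 0} := ⟨hF.2.1 hx, fun q hq => hq⟩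
  obtain ⟨t, ht, hmem⟩ := exists_pos_add_smul_mem hxf (sub_mem_dirOn hxf hy) fun q hq => hq
  refine hF.2.2 hy.1 hmem.1 hx ⟨t / (1 + t), 1 / (1 + t), by positivity, by positivity,
    by field_simp; ring, ?_⟩
  funext i j
  simp only [Pi.add_apply, Pi.smul_apply, Pi.sub_apply, smul_eq_mul]
  field_simp
  ring

lemma finite_facets : {F | IsFacet (transportationPolytope u v) F}.Finite := by
  refine ((Set.finite_range (faceOn u v)).insert ∅).subset fun F hF => ?_
  rcases F.eq_empty_or_nonempty with rfl | hne
  · exact Set.mem_insert _ _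
  · obtain ⟨Z, rfl⟩ := hF.1.eq_faceOn hne
    exact Set.mem_insert_of_mem _ ⟨Z, rfl⟩

lemma faceOn_empty : faceOn u v ∅ = transportationPolytope u v := by
  simp [faceOn]

lemma exists_pos_mem (hu : ∀ i, 0 < u i) (hv : ∀ j, 0 < v j) (hsum : ∑ i, u i = ∑ j, v j) :
    ∃ x ∈ transportationPolytope u v, ∀ i j, 0 < x i j := by
  have hV : 0 < ∑ j, v j := Finset.sum_pos (fun j _ => hv j) Finset.univ_nonempty
  have hpos : ∀ i j, 0 < u i * v j / ∑ j, v j :=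
    fun i j => div_pos (mul_pos (hu i) (hv j)) hV
  refine ⟨fun i j => u i * v j / ∑ j, v j, ⟨fun i j => (hpos i j).le, fun i => ?_, fun j => ?_⟩,
    hpos⟩
  · rw [← Finset.sum_div, ← Finset.mul_sum, mul_div_cancel_right₀ _ hV.ne']
  · rw [← Finset.sum_div, ← Finset.sum_mul, hsum, mul_div_cancel_left₀ _ hV.ne']

lemma exists_pos_mem_faceOn (hu : ∀ i, 0 < u i) (hv : ∀ j, 0 < v j)
    (hsum : ∑ i, u i = ∑ j, v j) {e e' : Fin 2} (he : e ≠ e') {k : Fin p} (h : u k < v e') :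
    ∃ x ∈ faceOn u v {(k, e)}, ∀ q ∉ ({(k, e)} : Set (Fin p × Fin 2)), 0 < x q.1 q.2 := by
  have hsum' := hsum
  rw [sum_fin_two_of_ne he, ← Finset.add_sum_erase _ _ (Finset.mem_univ k)] at hsum'
  have hV : 0 < v e + v e' - u k := by linarith [hv e]
  set y : Fin p → Fin 2 → ℝ := fun i f => if i = k then (if f = e then 0 else u k) else
    u i * ((if f = e then v e else v e' - u k) / (v e + v e' - u k)) with hy
  have h1 : y k e = 0 := by simp [hy]
  have h2 : y k e' = u k := by simp [hy, he.symm]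
  have h3 : ∀ i ≠ k, y i e = u i * (v e / (v e + v e' - u k)) := fun i hi => by simp [hy, hi]
  have h4 : ∀ i ≠ k, y i e' = u i * ((v e' - u k) / (v e + v e' - u k)) :=
    fun i hi => by simp [hy, hi, he.symm]
  have h3p : ∀ i ≠ k, 0 < y i e := fun i hi => by
    rw [h3 i hi]; exact mul_pos (hu i) (div_pos (hv e) hV)
  have h4p : ∀ i ≠ k, 0 < y i e' := fun i hi => by
    rw [h4 i hi]; exact mul_pos (hu i) (div_pos (by linarith) hV)
  refine ⟨y, ⟨(mem_transportationPolytope_iff hsum he).2 ⟨fun i => ?_, ?_⟩, ?_⟩, ?_⟩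
  · by_cases hi : i = k
    · subst hi
      rw [h1, h2]
      exact ⟨le_rfl, (hu i).le, zero_add _⟩
    · refine ⟨(h3p i hi).le, (h4p i hi).le, ?_⟩
      rw [h3 i hi, h4 i hi]
      field_simp
      ring
  · rw [← Finset.add_sum_erase _ _ (Finset.mem_univ k), h1,
      Finset.sum_congr rfl fun i hi => h3 i (Finset.ne_of_mem_erase hi), ← Finset.sum_mul]
    have : ∑ i ∈ Finset.univ.erase k, u i = v e + v e' - u k := by linarith
    rw [this]
    field_simp
    ring
  · rintro q rfl
    exact h1
  · rintro ⟨i, f⟩ hq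
    by_cases hi : i = k
    · subst hi
      have hf : f ≠ e := fun hf => hq (by simp [hf])
      simp [hy, hf, hu]
    · revert f
      simp only
      rw [forall_fin_two_of_ne he]
      exact ⟨fun _ => h3p i hi, fun _ => h4p i hi⟩

lemma setDim_transportationPolytope (hu : ∀ i, 0 < u i) (hv : ∀ j, 0 < v j)
    (hsum : ∑ i, u i = ∑ j, v j) :
    setDim (transportationPolytope u v) = Module.finrank ℝ (dirOn (∅ : Set (Fin p × Fin 2))) := by
  obtain ⟨x, hx, hpos⟩ := exists_pos_mem hu hv hsum
  rw [← faceOn_empty] at hx ⊢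
  exact setDim_faceOn hx fun q _ => (hpos q.1 q.2).ne'

lemma finrank_dirOn_empty_le (m : ℕ) :
    Module.finrank ℝ (dirOn (∅ : Set (Fin (m + 1) × Fin 2))) ≤ m := by
  let g : (Fin (m + 1) → Fin 2 → ℝ) →ₗ[ℝ] (Fin m → ℝ) :=
    { toFun := fun w i => w i.succ 0
      map_add' := fun _ _ => rfl
      map_smul' := fun _ _ => rfl }
  have hg : Function.Injective (g.domRestrict (dirOn (∅ : Set (Fin (m + 1) × Fin 2)))) := by
    rw [injective_iff_map_eq_zero]
    rintro ⟨w, hw1, hw2, hw3⟩ hw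
    have h0 : ∀ i : Fin m, w i.succ 0 = 0 := fun i => congrFun hw i
    have h0' : ∀ i, w i 0 = 0 := by
      intro i
      refine Fin.cases ?_ h0 i
      have := hw2 0
      rwa [Fin.sum_univ_succ, Finset.sum_eq_zero fun i _ => h0 i, add_zero] at this
    refine Subtype.ext (funext fun i => funext ?_)
    have := hw1 i
    rw [Fin.sum_univ_two, h0', zero_add] at this
    simp [Fin.forall_fin_two, h0', this]
  simpa using LinearMap.finrank_le_finrank_of_injective hg

lemma finrank_dirOn_singleton (hp : 2 ≤ p) (q : Fin p × Fin 2) :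
    Module.finrank ℝ (dirOn {q}) = Module.finrank ℝ (dirOn (∅ : Set (Fin p × Fin 2))) - 1 := by
  let g : (Fin p → Fin 2 → ℝ) →ₗ[ℝ] ℝ :=
    { toFun := fun w => w q.1 q.2
      map_add' := fun _ _ => rfl
      map_smul' := fun _ _ => rfl }
  set f := g.domRestrict (dirOn (∅ : Set (Fin p × Fin 2))) with hf
  have hker : (LinearMap.ker f).map (dirOn (∅ : Set (Fin p × Fin 2))).subtype = dirOn {q} := by
    ext w
    constructor
    · rintro ⟨⟨w, hw⟩, hwf, rfl⟩
      exact ⟨hw.1, hw.2.1, by rintro _ rfl; exact hwf⟩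
    · intro hw
      exact ⟨⟨w, hw.1, hw.2.1, by simp⟩, hw.2.2 q rfl, rfl⟩
  have hsurj : Function.Surjective f := by
    have : Nontrivial (Fin p) := Fin.nontrivial_iff_two_le.2 hp
    obtain ⟨j, hj⟩ := exists_ne q.1
    obtain ⟨e', he'⟩ := exists_ne q.2
    intro t
    refine ⟨⟨exchange q.2 q.1 j t 0, fun i => ?_, fun f => ?_, by simp⟩, ?_⟩
    · rw [sum_fin_two_of_ne he'.symm]
      simp [exchange, he']
    · simp [exchange, ← Finset.mul_sum]
    · change exchange q.2 q.1 j t 0 q.1 q.2 = t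
      simp [exchange, hj.symm]
  have h1 := f.finrank_range_add_finrank_ker
  rw [LinearMap.range_eq_top.2 hsurj, finrank_top, Module.finrank_self] at h1
  rw [← hker, Submodule.finrank_map_subtype_eq]
  omega

lemma isFacet_faceOn (hp : 2 ≤ p) (hu : ∀ i, 0 < u i) (hv : ∀ j, 0 < v j)
    (hsum : ∑ i, u i = ∑ j, v j) {e e' : Fin 2} (he : e ≠ e') {k : Fin p} (h : u k < v e') :
    IsFacet (transportationPolytope u v) (faceOn u v {(k, e)}) := by
  obtain ⟨x, hx, hpos⟩ := exists_pos_mem_faceOn hu hv hsum he h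
  refine ⟨isFace_faceOn _, ?_⟩
  rw [setDim_faceOn hx fun q hq => (hpos q hq).ne', finrank_dirOn_singleton hp,
    setDim_transportationPolytope hu hv hsum]

/-- Every pair `(i, j)` with `u i < v j` contributes a facet. -/
lemma card_add_card_le_numFacets (hp : 2 ≤ p) (hu : ∀ i, 0 < u i) (hv : ∀ j, 0 < v j)
    (hsum : ∑ i, u i = ∑ j, v j) {e e' : Fin 2} (he : e ≠ e') :
    (Finset.univ.filter fun i => u i < v e).card + (Finset.univ.filter fun i => u i < v e').card ≤
      numFacets (transportationPolytope u v) := by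
  classical
  have hzero : ∀ {k k' : Fin p} {f f' g : Fin 2}, f ≠ g → u k < v g →
      faceOn u v {(k, f)} = faceOn u v {(k', f')} → k' = k ∧ f' = f := by
    intro k k' f f' g hfg hk heq
    obtain ⟨x, hx, hpos⟩ := exists_pos_mem_faceOn hu hv hsum hfg hk
    by_contra hne
    refine (hpos (k', f') fun h => hne (by simpa using h)).ne' ?_
    rw [heq] at hx
    exact hx.2 _ rfl
  set A := Finset.univ.filter fun i => u i < v e with hA
  set B := Finset.univ.filter fun i => u i < v e' with hB
  have hcard : (A.image (fun k => faceOn u v {(k, e')}) ∪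
      B.image (fun k => faceOn u v {(k, e)})).card = A.card + B.card := by
    rw [Finset.card_union_of_disjoint, Finset.card_image_of_injOn, Finset.card_image_of_injOn]
    · intro k hk k' hk' heq
      exact (hzero he (by simpa [hB] using hk) heq).1.symm
    · intro k hk k' hk' heq
      exact (hzero he.symm (by simpa [hA] using hk) heq).1.symm
    · rw [Finset.disjoint_left]
      intro F hF hF'
      obtain ⟨k, hk, rfl⟩ := Finset.mem_image.1 hF
      obtain ⟨k', hk', heq⟩ := Finset.mem_image.1 hF'
      exact he.symm (hzero he (by simpa [hB] using hk') heq).2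
  rw [← hcard, ← Set.ncard_coe_finset]
  refine Set.ncard_le_ncard (fun F hF => ?_) finite_facets
  rw [Finset.mem_coe, Finset.mem_union, Finset.mem_image, Finset.mem_image] at hF
  rcases hF with ⟨k, hk, rfl⟩ | ⟨k, hk, rfl⟩
  · exact isFacet_faceOn hp hu hv hsum he.symm (by simpa [hA] using hk)
  · exact isFacet_faceOn hp hu hv hsum he (by simpa [hB] using hk)

lemma setDim_le (m : ℕ) {u : Fin (m + 1) → ℝ} (hu : ∀ i, 0 < u i) (hv : ∀ j, 0 < v j)
    (hsum : ∑ i, u i = ∑ j, v j) : setDim (transportationPolytope u v) ≤ m := by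
  rw [setDim_transportationPolytope hu hv hsum]
  exact finrank_dirOn_empty_le m

/-- In dimension at most one, the empty set and any vertex count as facets. -/
lemma two_le_numFacets (hd : setDim (transportationPolytope u v) ≤ 1)
    {a : Fin p → Fin 2 → ℝ} (ha : a ∈ Set.extremePoints ℝ (transportationPolytope u v)) :
    2 ≤ numFacets (transportationPolytope u v) := by
  have hd0 : setDim (transportationPolytope u v) - 1 = 0 := by omega
  refine (Set.ncard_pair (Set.singleton_ne_empty a).symm).ge.trans
    (Set.ncard_le_ncard ?_ finite_facets)
  rintro F (rfl | rfl)
  · refine ⟨⟨convex_empty, Set.empty_subset _, by simp⟩, ?_⟩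
    rw [hd0]
    simp [setDim]
  · refine ⟨⟨convex_singleton a, isExtreme_singleton.2 ha⟩, ?_⟩
    rw [hd0]
    simp [setDim, direction_affineSpan]

lemma HasPathOfLength.refl {E : Type*} [AddCommGroup E] [Module ℝ E] (P : Set E) (a : E) :
    HasPathOfLength P a a 0 :=
  ⟨fun _ => a, rfl, rfl, fun i hi => absurd hi (Nat.not_lt_zero i)⟩

lemma HasPathOfLength.cons {E : Type*} [AddCommGroup E] [Module ℝ E] {P : Set E} {a b c : E}
    {L : ℕ} (hac : PolyAdj P a c) (h : HasPathOfLength P c b L) :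
    HasPathOfLength P a b (L + 1) := by
  obtain ⟨f, hf0, hfL, hf⟩ := h
  refine ⟨fun n => Nat.casesOn n a f, rfl, hfL, fun i hi => ?_⟩
  cases i with
  | zero => simpa [hf0] using hac
  | succ i => exact hf i (by omega)

lemma sum_exchange (e f : Fin 2) (k j : Fin p) (t : ℝ) (x : Fin p → Fin 2 → ℝ) :
    ∑ i, exchange e k j t x i f = ∑ i, x i f := by
  simp [exchange, Finset.sum_add_distrib, ← Finset.mul_sum]

section exchange

variable {e e' : Fin 2} {k j : Fin p}

lemma exchange_left (hkj : k ≠ j) (t : ℝ) (x : Fin p → Fin 2 → ℝ) :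
    exchange e k j t x k e = x k e + t := by
  simp [exchange, hkj]

lemma exchange_left' (h : e ≠ e') (hkj : k ≠ j) (t : ℝ) (x : Fin p → Fin 2 → ℝ) :
    exchange e k j t x k e' = x k e' - t := by
  simp [exchange, hkj, h.symm, sub_eq_add_neg]

lemma exchange_right (hkj : k ≠ j) (t : ℝ) (x : Fin p → Fin 2 → ℝ) :
    exchange e k j t x j e = x j e - t := by
  simp [exchange, hkj.symm, sub_eq_add_neg]

lemma exchange_right' (h : e ≠ e') (hkj : k ≠ j) (t : ℝ) (x : Fin p → Fin 2 → ℝ) :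
    exchange e k j t x j e' = x j e' + t := by
  simp [exchange, hkj.symm, h.symm]

/-- If `x` and its exchange along rows `k` and `j` are vertices, they are adjacent. -/
lemma polyAdj_exchange {x : Fin p → Fin 2 → ℝ} (hkj : k ≠ j) {t : ℝ} (ht : t ≠ 0) {m m' : Fin p}
    (hx : IsBasicAt u v x m) (hx' : IsBasicAt u v (exchange e k j t x) m')
    (h : ∀ i, i ≠ k → i ≠ j → ∃ f, x i f = 0) :
    PolyAdj (transportationPolytope u v) x (exchange e k j t x) := by
  refine polyAdj_of_rows_eq hx.mem_extremePoints hx'.mem_extremePoints (fun heq => ht ?_)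
    (k := k) (j := j) fun i hk hj => ⟨(exchange_of_ne t x hk hj).symm, h i hk hj⟩
  have := congrFun (congrFun heq k) e
  rw [exchange_left hkj] at this
  linarith

end exchange

/-- The rows in which two matrices differ. -/
def diffRows (x y : Fin p → Fin 2 → ℝ) : Finset (Fin p) :=
  open Classical in Finset.univ.filter fun i => x i ≠ y i

lemma mem_diffRows {x y : Fin p → Fin 2 → ℝ} {i : Fin p} : i ∈ diffRows x y ↔ x i ≠ y i := by
  simp [diffRows]

/-- If two points of the polytope differ in a row, they are strictly ordered in some column. -/
lemma exists_lt_of_row_ne {x y : Fin p → Fin 2 → ℝ} (hx : x ∈ transportationPolytope u v)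
    (hy : y ∈ transportationPolytope u v) {k : Fin p} (h : x k ≠ y k) :
    ∃ e e' : Fin 2, e ≠ e' ∧ x k e < y k e ∧ y k e' < x k e' := by
  have e01 : (0 : Fin 2) ≠ 1 := by decide
  have h1 := hx.2.1 k
  have h2 := hy.2.1 k
  rw [Fin.sum_univ_two] at h1 h2
  rcases lt_trichotomy (x k 0) (y k 0) with hlt | heq | hlt
  · exact ⟨0, 1, e01, hlt, by linarith⟩
  · refine absurd (funext fun f => ?_) h
    revert f
    rw [Fin.forall_fin_two]
    exact ⟨heq, by linarith⟩
  · exact ⟨1, 0, e01.symm, by linarith, hlt⟩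

lemma exists_row_ne {x y : Fin p → Fin 2 → ℝ} (hx : x ∈ transportationPolytope u v)
    (hy : y ∈ transportationPolytope u v) (h : x ≠ y) (l : Fin p) : ∃ m ≠ l, x m ≠ y m := by
  by_contra! hcon
  exact h (eq_of_rows_eq hx hy hcon)

/-- If row `l` can always compensate for the others, each step fixes one further row. -/
lemma exists_path_of_compensating (hsum : ∑ i, u i = ∑ j, v j) {b : Fin p → Fin 2 → ℝ} {l : Fin p}
    (hb : IsBasicAt u v b l) {c : Fin p → Fin 2 → ℝ} {k : Fin p} (hc : IsBasicAt u v c k)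
    (h : (∃ e, ∀ i ≠ l, c i e ≤ b i e) ∨ ∀ j, v j ≤ u l) :
    ∃ L ≤ ((diffRows c b).erase l).card, HasPathOfLength (transportationPolytope u v) c b L := by
  induction hn : ((diffRows c b).erase l).card using Nat.strong_induction_on generalizing c k with
  | _ n ih =>
  subst hn
  by_cases hcb : c = b
  · subst hcb
    exact ⟨0, Nat.zero_le _, .refl _ _⟩
  obtain ⟨m, hml, hmne, hm⟩ : ∃ m ≠ l, c m ≠ b m ∧ ∀ i, i ≠ m → i ≠ l → ∃ f, c i f = 0 := by
    by_cases hk : k ≠ l ∧ c k ≠ b k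
    · exact ⟨k, hk.1, hk.2, fun i hi _ => hc.2 i hi⟩
    · obtain ⟨m, hml, hm⟩ := exists_row_ne hc.1 hb.1 hcb l
      refine ⟨m, hml, hm, fun i _ hil => ?_⟩
      by_cases hik : i = k
      · subst hik
        have : c i = b i := by tauto
        rw [this]
        exact hb.2 i hil
      · exact hc.2 i hik
  obtain ⟨e, he⟩ : ∃ e, (∀ i ≠ l, c i e ≤ b i e) ∨ ∀ j, v j ≤ u l := by
    rcases h with ⟨e, he⟩ | h
    · exact ⟨e, Or.inl he⟩
    · exact ⟨0, Or.inr h⟩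
  obtain ⟨e', hee⟩ := exists_ne e
  replace hee := hee.symm
  have hcm := hc.1.2.1 m
  have hbm := hb.1.2.1 m
  have hcl := hc.1.2.1 l
  rw [sum_fin_two_of_ne hee] at hcm hbm hcl
  set t := b m e - c m e with ht
  set c' := exchange e m l t c with hc'
  have hm_e : c' m e = b m e := by rw [hc', exchange_left hml]; linarith
  have hm_e' : c' m e' = b m e' := by rw [hc', exchange_left' hee hml]; linarith
  have hm_eq : c' m = b m := by
    funext f
    revert f
    rw [forall_fin_two_of_ne hee]
    exact ⟨hm_e, hm_e'⟩
  have hoth : ∀ i, i ≠ m → i ≠ l → c' i = c i := fun i him hil => exchange_of_ne t c him hil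
  have hle : (c l e - t) + ∑ i ∈ Finset.univ.erase l, c' i e = v e := by
    rw [← exchange_right hml t c]
    exact (Finset.add_sum_erase _ (fun i => c' i e) (Finset.mem_univ l)).trans
      ((sum_exchange e e m l t c).trans (hc.1.2.2 e))
  have hle' : (c l e' + t) + ∑ i ∈ Finset.univ.erase l, c' i e' = v e' := by
    rw [← exchange_right' hee hml t c]
    exact (Finset.add_sum_erase _ (fun i => c' i e') (Finset.mem_univ l)).trans
      ((sum_exchange e e' m l t c).trans (hc.1.2.2 e'))
  have hnn : ∀ f, 0 ≤ ∑ i ∈ Finset.univ.erase l, c' i f := by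
    refine fun f => Finset.sum_nonneg fun i hi => ?_
    by_cases him : i = m
    · rw [him, hm_eq]
      exact hb.1.1 _ _
    · rw [hoth i him (Finset.ne_of_mem_erase hi)]
      exact hc.1.1 _ _
  have hbound : 0 ≤ c l e - t ∧ 0 ≤ c l e' + t := by
    rcases he with he | h
    · have hs : ∑ i ∈ Finset.univ.erase l, c' i e ≤ ∑ i ∈ Finset.univ.erase l, b i e := by
        refine Finset.sum_le_sum fun i hi => ?_
        by_cases him : i = m
        · rw [him, hm_eq]
        · rw [hoth i him (Finset.ne_of_mem_erase hi)]
          exact he i (Finset.ne_of_mem_erase hi)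
      have hb1 := hb.1.2.2 e
      rw [← Finset.add_sum_erase _ _ (Finset.mem_univ l)] at hb1
      have := hb.1.1 l e
      have := he m hml
      have := hc.1.1 l e'
      constructor <;> linarith
    · have := hnn e
      have := hnn e'
      have := h e
      have := h e'
      constructor <;> linarith
  have hmem : c' ∈ transportationPolytope u v :=
    exchange_mem hsum hee hml hc.1 (by have := hb.1.1 m e; linarith)
      (by have := hb.1.1 m e'; linarith) hbound.1 hbound.2
  have hbasic : IsBasicAt u v c' l := by
    refine ⟨hmem, fun i hil => ?_⟩
    by_cases him : i = m
    · rw [him, hm_eq]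
      exact hb.2 m hml
    · rw [hoth i him hil]
      exact hm i him hil
  have hne : t ≠ 0 := by
    intro h0
    refine hmne (funext ?_)
    rw [forall_fin_two_of_ne hee]
    constructor <;> linarith
  have hadj := polyAdj_exchange hml hne hc hbasic hm
  have hlt : ((diffRows c' b).erase l).card < ((diffRows c b).erase l).card := by
    refine Finset.card_lt_card (Finset.ssubset_iff_of_subset ?_ |>.2 ⟨m, ?_, ?_⟩)
    · intro i hi
      rw [Finset.mem_erase, mem_diffRows] at hi ⊢
      have him : i ≠ m := fun h => hi.2 (by rw [h, hm_eq])
      rw [← hoth i him hi.1]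
      exact hi
    · simp [hml, mem_diffRows, hmne]
    · simp [mem_diffRows, hm_eq]
  obtain ⟨L, hL, hpath⟩ := ih _ hlt hbasic (by
    refine he.imp (fun he => ⟨e, fun i hil => ?_⟩) id
    by_cases him : i = m
    · rw [him, hm_eq]
    · rw [hoth i him hil]
      exact he i hil) rfl
  exact ⟨L + 1, by omega, .cons hadj hpath⟩

/-- A pivot on rows `k` and `j`, one of which becomes equal to the corresponding row of `b`. -/
lemma exists_pivot (hsum : ∑ i, u i = ∑ j, v j) {e e' : Fin 2} (he : e ≠ e') {k j : Fin p}
    (hkj : k ≠ j) {c : Fin p → Fin 2 → ℝ} (hc : IsBasicAt u v c k) (hk : 0 < c k e')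
    (hj : 0 < c j e) :
    ∃ c', PolyAdj (transportationPolytope u v) c c' ∧ (∀ i, i ≠ k → i ≠ j → c' i = c i) ∧
      ((c' k e' = 0 ∧ IsBasicAt u v c' j) ∨ (c' j e = 0 ∧ IsBasicAt u v c' k)) := by
  set t := min (c k e') (c j e) with ht
  have ht0 : 0 < t := lt_min hk hj
  have h1 : t ≤ c k e' := min_le_left _ _
  have h2 : t ≤ c j e := min_le_right _ _
  have h3 := hc.1.1 k e
  have h4 := hc.1.1 j e'
  have hmem : exchange e k j t c ∈ transportationPolytope u v :=
    exchange_mem hsum he hkj hc.1 (by linarith) (by linarith) (by linarith) (by linarith)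
  have hoth : ∀ i, i ≠ k → i ≠ j → exchange e k j t c i = c i :=
    fun i hik hij => exchange_of_ne t c hik hij
  have hcase : (exchange e k j t c k e' = 0 ∧ IsBasicAt u v (exchange e k j t c) j) ∨
      (exchange e k j t c j e = 0 ∧ IsBasicAt u v (exchange e k j t c) k) := by
    rcases min_choice (c k e') (c j e) with h | h
    · have h0 : exchange e k j t c k e' = 0 := by
        rw [exchange_left' he hkj]; linarith
      refine Or.inl ⟨h0, hmem, fun i hij => ?_⟩
      by_cases hik : i = k
      · exact ⟨e', hik ▸ h0⟩
      · rw [hoth i hik hij]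
        exact hc.2 i hik
    · have h0 : exchange e k j t c j e = 0 := by
        rw [exchange_right hkj]; linarith
      refine Or.inr ⟨h0, hmem, fun i hik => ?_⟩
      by_cases hij : i = j
      · exact ⟨e, hij ▸ h0⟩
      · rw [hoth i hik hij]
        exact hc.2 i hik
  refine ⟨_, ?_, hoth, hcase⟩
  rcases hcase with h | h
  · exact polyAdj_exchange hkj ht0.ne' hc h.2 fun i hik _ => hc.2 i hik
  · exact polyAdj_exchange hkj ht0.ne' hc h.2 fun i hik _ => hc.2 i hik

lemma IsBasicAt.of_zero {x : Fin p → Fin 2 → ℝ} {k : Fin p} (hx : IsBasicAt u v x k)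
    (h : ∃ f, x k f = 0) (m : Fin p) : IsBasicAt u v x m := by
  refine ⟨hx.1, fun i _ => ?_⟩
  by_cases hik : i = k
  · rwa [hik]
  · exact hx.2 i hik

lemma IsBasicAt.eq_zero_of_pos {x : Fin p → Fin 2 → ℝ} {k i : Fin p} (hx : IsBasicAt u v x k)
    (hik : i ≠ k) {e e' : Fin 2} (he : e ≠ e') (h : 0 < x i e) : x i e' = 0 := by
  rcases (exists_fin_two_of_ne he).1 (hx.2 i hik) with h0 | h0
  · exact absurd h0 h.ne'
  · exact h0

lemma exists_path_of_ne (hsum : ∑ i, u i = ∑ j, v j) {b : Fin p → Fin 2 → ℝ} {l : Fin p}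
    (hb : IsBasicAt u v b l) {c : Fin p → Fin 2 → ℝ} {k : Fin p} (hc : IsBasicAt u v c k)
    (hkl : k ≠ l) :
    ∃ L ≤ (diffRows c b).card - 1, HasPathOfLength (transportationPolytope u v) c b L := by
  induction hn : (diffRows c b).card using Nat.strong_induction_on generalizing c k with
  | _ n ih =>
  subst hn
  by_cases hcb : c = b
  · subst hcb
    exact ⟨0, Nat.zero_le _, .refl _ _⟩
  by_cases hcomp : ∃ e, ∀ i ≠ l, c i e ≤ b i e
  · obtain ⟨L, hL, hpath⟩ := exists_path_of_compensating hsum hb hc (Or.inl hcomp)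
    have hl : l ∈ diffRows c b := by
      obtain ⟨e, he⟩ := hcomp
      rw [mem_diffRows]
      intro hl
      have hle : ∀ i ∈ Finset.univ, c i e ≤ b i e := by
        intro i _
        by_cases hil : i = l
        · rw [hil, hl]
        · exact he i hil
      have heq := (Finset.sum_eq_sum_iff_of_le hle).1 (by rw [hc.1.2.2, hb.1.2.2])
      obtain ⟨m, -, hm⟩ := exists_row_ne hc.1 hb.1 hcb l
      obtain ⟨f, f', hff, h1, h2⟩ := exists_lt_of_row_ne hc.1 hb.1 hm
      have := heq m (Finset.mem_univ m)
      rcases (forall_fin_two_of_ne hff (Q := fun g => g = f ∨ g = f')).2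
        ⟨Or.inl rfl, Or.inr rfl⟩ e with rfl | rfl <;> linarith
    rw [Finset.card_erase_of_mem hl] at hL
    exact ⟨L, hL, hpath⟩
  push Not at hcomp
  obtain ⟨k, hkl, hc, hkne⟩ : ∃ k ≠ l, IsBasicAt u v c k ∧ c k ≠ b k := by
    by_cases hk : c k = b k
    · obtain ⟨m, hml, hm⟩ := exists_row_ne hc.1 hb.1 hcb l
      exact ⟨m, hml, hc.of_zero (by rw [hk]; exact hb.2 k hkl) m, hm⟩
    · exact ⟨k, hkl, hc, hk⟩
  obtain ⟨e, e', he, hk1, hk2⟩ := exists_lt_of_row_ne hc.1 hb.1 hkne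
  obtain ⟨j, hjl, hj⟩ := hcomp e
  have hjk : j ≠ k := by
    rintro rfl
    exact lt_asymm hk1 hj
  have hbk : b k e' = 0 := hb.eq_zero_of_pos hkl he ((hc.1.1 k e).trans_lt hk1)
  have hcj : c j e' = 0 := hc.eq_zero_of_pos hjk he ((hb.1.1 j e).trans_lt hj)
  have hbj : b j e = 0 := by
    have hpos : 0 < b j e' := by
      have h1 := hc.1.2.1 j
      have h2 := hb.1.2.1 j
      rw [sum_fin_two_of_ne he] at h1 h2
      linarith
    exact hb.eq_zero_of_pos hjl he.symm hpos
  obtain ⟨c', hadj, hoth, hcase⟩ := exists_pivot hsum he hjk.symm hc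
    ((hb.1.1 k e').trans_lt hk2) ((hb.1.1 j e).trans_lt hj)
  have hjne : c j ≠ b j := fun h => by rw [h] at hj; exact lt_irrefl _ hj
  have hlt : ∀ m, c m ≠ b m → c' m = b m → (diffRows c' b).card < (diffRows c b).card := by
    intro m hm hm'
    refine Finset.card_lt_card (Finset.ssubset_iff_of_subset ?_ |>.2 ⟨m, ?_, ?_⟩)
    · intro i hi
      rw [mem_diffRows] at hi ⊢
      by_cases hik : i = k
      · rwa [hik]
      by_cases hij : i = j
      · rwa [hij]
      rwa [← hoth i hik hij]
    · rwa [mem_diffRows]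
    · simp [mem_diffRows, hm']
  obtain ⟨k', hk'l, hc', hlt⟩ : ∃ k' ≠ l, IsBasicAt u v c' k' ∧
      (diffRows c' b).card < (diffRows c b).card := by
    rcases hcase with ⟨h0, hbas⟩ | ⟨h0, hbas⟩
    · exact ⟨j, hjl, hbas, hlt k hkne (row_eq_of_zero hbas.1 hb.1 h0 hbk)⟩
    · exact ⟨k, hkl, hbas, hlt j hjne (row_eq_of_zero hbas.1 hb.1 h0 hbj)⟩
  have htwo : 2 ≤ (diffRows c b).card :=
    Finset.one_lt_card.2 ⟨k, mem_diffRows.2 hkne, j, mem_diffRows.2 hjne, hjk.symm⟩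
  obtain ⟨L, hL, hpath⟩ := ih _ hlt hc' hk'l rfl
  exact ⟨L + 1, by omega, .cons hadj hpath⟩

lemma exists_path (hsum : ∑ i, u i = ∑ j, v j) {b : Fin p → Fin 2 → ℝ} {l : Fin p}
    (hb : IsBasicAt u v b l) {c : Fin p → Fin 2 → ℝ} (hc : IsBasicAt u v c l) :
    ∃ L ≤ (insert l (diffRows c b)).card,
      HasPathOfLength (transportationPolytope u v) c b L := by
  induction hn : (insert l (diffRows c b)).card using Nat.strong_induction_on generalizing c with
  | _ n ih =>
  subst hn
  by_cases hcb : c = b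
  · subst hcb
    exact ⟨0, Nat.zero_le _, .refl _ _⟩
  obtain ⟨j, hjl, hjne⟩ := exists_row_ne hc.1 hb.1 hcb l
  by_cases hl : ∃ f, c l f = 0
  · obtain ⟨L, hL, hpath⟩ := exists_path_of_ne hsum hb (hc.of_zero hl j) hjl
    have := Finset.card_le_card (Finset.subset_insert l (diffRows c b))
    exact ⟨L, by omega, hpath⟩
  push Not at hl
  obtain ⟨e', e, he, hj', hj⟩ := exists_lt_of_row_ne hc.1 hb.1 hjne
  have hbj : b j e = 0 := hb.eq_zero_of_pos hjl he ((hc.1.1 j e').trans_lt hj')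
  obtain ⟨c', hadj, hoth, hcase⟩ := exists_pivot hsum he.symm hjl.symm hc
    (lt_of_le_of_ne (hc.1.1 l e') (hl e').symm) ((hb.1.1 j e).trans_lt hj)
  have hsub : diffRows c' b ⊆ insert l (diffRows c b) := by
    intro i hi
    rw [Finset.mem_insert, mem_diffRows]
    rw [mem_diffRows] at hi
    by_cases hil : i = l
    · exact Or.inl hil
    by_cases hij : i = j
    · exact Or.inr (hij ▸ hjne)
    · rw [hoth i hil hij] at hi
      exact Or.inr hi
  have hpos : 0 < (insert l (diffRows c b)).card := Finset.card_pos.2 ⟨l, by simp⟩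
  rcases hcase with ⟨-, hbas⟩ | ⟨h0, hbas⟩
  · obtain ⟨L, hL, hpath⟩ := exists_path_of_ne hsum hb hbas hjl
    have := Finset.card_le_card hsub
    exact ⟨L + 1, by omega, .cons hadj hpath⟩
  · have hlt : (insert l (diffRows c' b)).card < (insert l (diffRows c b)).card := by
      refine Finset.card_lt_card (Finset.ssubset_iff_of_subset ?_ |>.2 ⟨j, ?_, ?_⟩)
      · exact Finset.insert_subset (by simp) hsub
      · simp [mem_diffRows, hjne]
      · simp [mem_diffRows, hjl, row_eq_of_zero hbas.1 hb.1 h0 hbj]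
    obtain ⟨L, hL, hpath⟩ := ih _ hlt hbas rfl
    exact ⟨L + 1, by omega, .cons hadj hpath⟩

lemma eq_zero_of_le_entry {x : Fin p → Fin 2 → ℝ} (hx : x ∈ transportationPolytope u v)
    {e : Fin 2} {i : Fin p} (h : v e ≤ x i e) {k : Fin p} (hk : k ≠ i) : x k e = 0 := by
  have h1 := hx.2.2 e
  rw [← Finset.add_sum_erase _ _ (Finset.mem_univ i)] at h1
  have h2 := Finset.single_le_sum (f := fun i => x i e) (fun j _ => hx.1 j e)
    (Finset.mem_erase.2 ⟨hk, Finset.mem_univ k⟩)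
  have := hx.1 k e
  linarith

lemma entry_eq_of_zero {x : Fin p → Fin 2 → ℝ} (hx : x ∈ transportationPolytope u v)
    {e e' : Fin 2} (he : e ≠ e') {i : Fin p} (h : x i e' = 0) : x i e = u i := by
  have := hx.2.1 i
  rw [sum_fin_two_of_ne he] at this
  linarith

/-- A vertex is nonzero in column `e` in at most one of the rows with `v e ≤ u i`, and it is basic
at that row. -/
lemma exists_isBasicAt_large (hp : 0 < p) (hsum : ∑ i, u i = ∑ j, v j) {e e' : Fin 2}
    (he : e ≠ e') {x : Fin p → Fin 2 → ℝ}
    (hx : x ∈ Set.extremePoints ℝ (transportationPolytope u v)) :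
    ∃ k, IsBasicAt u v x k ∧ ∀ i ≠ k, v e ≤ u i → x i e = 0 := by
  obtain ⟨k, hk⟩ := exists_isBasicAt hp hsum hx
  by_cases hex : ∃ i, v e ≤ u i ∧ x i e ≠ 0
  · obtain ⟨i, hi, hxi⟩ := hex
    have hbas : IsBasicAt u v x i := by
      by_cases hik : i = k
      · rwa [hik]
      · have h0 := hk.eq_zero_of_pos hik he (lt_of_le_of_ne (hx.1.1 i e) hxi.symm)
        refine ⟨hx.1, fun j hj => ⟨e, eq_zero_of_le_entry hx.1 ?_ hj⟩⟩
        rwa [entry_eq_of_zero hx.1 he h0]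
    refine ⟨i, hbas, fun j hj hvj => ?_⟩
    rcases (exists_fin_two_of_ne he).1 (hbas.2 j hj) with h0 | h0
    · exact h0
    · refine absurd (eq_zero_of_le_entry hx.1 ?_ hj.symm) hxi
      rwa [entry_eq_of_zero hx.1 he h0]
  · push Not at hex
    exact ⟨k, hk, fun i _ hi => hex i hi⟩

/-- Every vertex is basic at a row whose marginal is at least as large as all column marginals. -/
lemma isBasicAt_of_le (hp : 0 < p) (hsum : ∑ i, u i = ∑ j, v j) {i : Fin p}
    (hi : ∀ j, v j ≤ u i) {x : Fin p → Fin 2 → ℝ}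
    (hx : x ∈ Set.extremePoints ℝ (transportationPolytope u v)) : IsBasicAt u v x i := by
  obtain ⟨k, hk⟩ := exists_isBasicAt hp hsum hx
  by_cases hik : i = k
  · rwa [hik]
  · obtain ⟨f, hf⟩ := hk.2 i hik
    obtain ⟨f', hff⟩ := exists_ne f
    refine ⟨hx.1, fun j hj => ⟨f', eq_zero_of_le_entry hx.1 ?_ hj⟩⟩
    rw [entry_eq_of_zero hx.1 hff hf]
    exact hi f'

lemma add_lt_add_of_three_le (hp : 2 < p) (hu : ∀ i, 0 < u i) (hsum : ∑ i, u i = ∑ j, v j)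
    {e e' : Fin 2} (he : e ≠ e') {i j : Fin p} (hij : i ≠ j) : u i + u j < v e + v e' := by
  rw [← sum_fin_two_of_ne he, ← hsum, ← Finset.sum_pair hij]
  have hcard : ({i, j} : Finset (Fin p)).card < (Finset.univ : Finset (Fin p)).card := by
    rw [Finset.card_pair hij, Finset.card_fin]
    exact hp
  obtain ⟨k, -, hk⟩ := Finset.exists_mem_notMem_of_card_lt_card hcard
  exact Finset.sum_lt_sum_of_subset (Finset.subset_univ _) (Finset.mem_univ k) hk (hu k)
    fun l _ _ => (hu l).le

lemma exists_short_path (hp : 2 < p) (hu : ∀ i, 0 < u i) (hsum : ∑ i, u i = ∑ j, v j)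
    {a b : Fin p → Fin 2 → ℝ} (ha : a ∈ Set.extremePoints ℝ (transportationPolytope u v))
    (hb : b ∈ Set.extremePoints ℝ (transportationPolytope u v)) :
    ∃ e e' : Fin 2, e ≠ e' ∧ ∃ L, L + (p - 1) ≤
      (Finset.univ.filter fun i => u i < v e).card +
        (Finset.univ.filter fun i => u i < v e').card ∧
      HasPathOfLength (transportationPolytope u v) a b L := by
  classical
  have hp0 : 0 < p := by omega
  have e01 : (0 : Fin 2) ≠ 1 := by decide
  by_cases hbig : ∃ i, ∀ j, v j ≤ u i
  · obtain ⟨i, hi⟩ := hbig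
    obtain ⟨L, hL, hpath⟩ := exists_path_of_compensating hsum (isBasicAt_of_le hp0 hsum hi hb)
      (isBasicAt_of_le hp0 hsum hi ha) (Or.inr hi)
    have hcard : ∀ e e' : Fin 2, e ≠ e' →
        p - 1 ≤ (Finset.univ.filter fun i => u i < v e).card := by
      intro e e' he
      have hsub : Finset.univ.erase i ⊆ Finset.univ.filter fun i => u i < v e := by
        intro j hj
        have := add_lt_add_of_three_le hp hu hsum he (Finset.ne_of_mem_erase hj)
        have := hi e'
        simp only [Finset.mem_filter, Finset.mem_univ, true_and]
        linarith
      simpa using Finset.card_le_card hsub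
    have hL' : L ≤ p - 1 := by
      have := Finset.card_le_card (Finset.erase_subset_erase i (Finset.subset_univ (diffRows a b)))
      rw [Finset.card_erase_of_mem (Finset.mem_univ i), Finset.card_fin] at this
      omega
    have h0 := hcard 0 1 e01
    have h1 := hcard 1 0 e01.symm
    exact ⟨0, 1, e01, L, by omega, hpath⟩
  push Not at hbig
  obtain ⟨e, e', he, hsmall⟩ : ∃ e e' : Fin 2, e ≠ e' ∧ ∀ i, u i < v e' := by
    by_cases h1 : ∀ i, u i < v 1
    · exact ⟨0, 1, e01, h1⟩
    refine ⟨1, 0, e01.symm, fun j => ?_⟩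
    by_contra! hj
    push Not at h1
    obtain ⟨i, hi⟩ := h1
    have hij : j ≠ i := by
      rintro rfl
      obtain ⟨f, hf⟩ := hbig j
      revert f
      rw [Fin.forall_fin_two]
      exact ⟨hj.not_gt, hi.not_gt⟩
    have := add_lt_add_of_three_le hp hu hsum e01 hij
    linarith
  refine ⟨e, e', he, ?_⟩
  rw [Finset.filter_true_of_mem (p := fun i => u i < v e') fun i _ => hsmall i, Finset.card_fin]
  set A := Finset.univ.filter fun i => u i < v e with hA
  obtain ⟨k, hk, hka⟩ := exists_isBasicAt_large hp0 hsum he ha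
  obtain ⟨l, hl, hlb⟩ := exists_isBasicAt_large hp0 hsum he hb
  have hsub : diffRows a b ⊆ insert k (insert l A) := by
    intro i hi
    rw [mem_diffRows] at hi
    by_contra hcon
    simp only [Finset.mem_insert, not_or, hA, Finset.mem_filter, Finset.mem_univ, true_and,
      not_lt] at hcon
    exact hi (row_eq_of_zero ha.1 hb.1 (hka i hcon.1 hcon.2.2) (hlb i hcon.2.1 hcon.2.2))
  have hc1 := Finset.card_insert_le l A
  have hc2 := Finset.card_insert_le k (insert l A)
  by_cases hkl : k = l
  · subst hkl
    obtain ⟨L, hL, hpath⟩ := exists_path hsum hl hk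
    have := Finset.card_le_card (Finset.insert_subset (Finset.mem_insert_self k _) hsub)
    rw [Finset.insert_idem] at this
    exact ⟨L, by omega, hpath⟩
  · obtain ⟨L, hL, hpath⟩ := exists_path_of_ne hsum hl hk hkl
    have := Finset.card_le_card hsub
    exact ⟨L, by omega, hpath⟩

end

/-- The Hirsch Conjecture holds for `p × 2` classical transportation polytopes: any two
vertices are joined by a path of length at most `n - d`. -/
theorem hirsch_transportationPolytope_p2
    (p : ℕ) (hp : 2 ≤ p) (u : Fin p → ℝ) (v : Fin 2 → ℝ)
    (hu : ∀ i, 0 < u i) (hv : ∀ j, 0 < v j)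
    (hsum : ∑ i, u i = ∑ j, v j) :
    ∀ a ∈ Set.extremePoints ℝ (transportationPolytope u v),
      ∀ b ∈ Set.extremePoints ℝ (transportationPolytope u v),
        ∃ L ≤ numFacets (transportationPolytope u v) - setDim (transportationPolytope u v),
          HasPathOfLength (transportationPolytope u v) a b L := by
  intro a ha b hb
  obtain ⟨m, rfl⟩ : ∃ m, p = m + 1 := ⟨p - 1, by omega⟩
  have hd := setDim_le m hu hv hsum
  rcases hp.eq_or_lt with hp2 | hp3
  · obtain rfl : m = 1 := by omega
    have hn := two_le_numFacets hd ha
    by_cases hab : a = b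
    · subst hab
      exact ⟨0, Nat.zero_le _, .refl _ _⟩
    · refine ⟨1, by omega, .cons (polyAdj_of_rows_eq ha hb hab (k := 0) (j := 1) ?_) (.refl _ _)⟩
      intro i h0 h1
      fin_cases i
      · exact absurd rfl h0
      · exact absurd rfl h1
  · obtain ⟨e, e', he, L, hL, hpath⟩ := exists_short_path hp3 hu hsum ha hb
    have hn := card_add_card_le_numFacets hp hu hv hsum he
    exact ⟨L, by omega, hpath⟩
end
end

section
/- Fix integers n ≥ 2 and 1 ≤ k < n. Let A = { (i,j) ∈ Fin n × Fin n | 1 ≤ (i : ℕ) − (j : ℕ) ≤ k } be the arc set of the directed acyclic graph G_{n,k} (arcs directed from i to j), and let b : Fin n → ℝ be any supply vector. Let P = { x : Fin n → Fin n → ℝ | x i j ≥ 0 for all i j, x i j = 0 whenever (i,j) ∉ A, and for every node i, ∑_j x i j − ∑_j x j i = b i } be the singly-capacitated network flow polytope of G_{n,k}. Then any two extreme points of P are joined by a path in the graph G(P) of length at most 2 · Set.ncard A. -/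
open scoped BigOperators

noncomputable section

/-- The arc set of the directed acyclic graph `G_{n,k}`: arcs from `i` to `j` whenever
`1 ≤ i - j ≤ k`. -/
def gnkArcs (n k : ℕ) : Set (Fin n × Fin n) :=
  {ij | 1 ≤ (ij.1 : ℕ) - (ij.2 : ℕ) ∧ (ij.1 : ℕ) - (ij.2 : ℕ) ≤ k}

/-- The singly-capacitated network flow polytope on node set `Fin n` with arc set `A` and
supply vector `b`. -/
def flowPolytope (n : ℕ) (A : Set (Fin n × Fin n)) (b : Fin n → ℝ) :
    Set (Fin n → Fin n → ℝ) :=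
  {x | (∀ i j, 0 ≤ x i j) ∧ (∀ i j, (i, j) ∉ A → x i j = 0) ∧
    (∀ i, (∑ j, x i j) - (∑ j, x j i) = b i)}

/-- The net outflow of `x` at each node, as a linear map. -/
def netOutflow (n : ℕ) : (Fin n → Fin n → ℝ) →ₗ[ℝ] (Fin n → ℝ) where
  toFun x i := (∑ j, x i j) - (∑ j, x j i)
  map_add' x y := by
    ext i
    simp only [Pi.add_apply, Finset.sum_add_distrib]
    ring
  map_smul' c x := by
    ext i
    simp only [Pi.smul_apply, smul_eq_mul, ← Finset.mul_sum, RingHom.id_apply]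
    ring

/-- The unit flow on the single arc `(p, q)`. -/
def unitFlow {n : ℕ} (p q : Fin n) : Fin n → Fin n → ℝ :=
  fun i j => if i = p ∧ j = q then 1 else 0

/-- The flow `x` vanishes outside the arc set `S`. -/
def SupportedOn {n : ℕ} (S : Set (Fin n × Fin n)) (x : Fin n → Fin n → ℝ) : Prop :=
  ∀ i j, (i, j) ∉ S → x i j = 0

/-- The arc set `S` carries no nonzero circulation, i.e. it is a forest. -/
def IsForest {n : ℕ} (S : Set (Fin n × Fin n)) : Prop :=
  ∀ g, netOutflow n g = 0 → SupportedOn S g → g = 0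

/-- The arcs `(j + 1, j)` with `m ≤ j`. -/
def pathArcs (n m : ℕ) : Set (Fin n × Fin n) :=
  {e | (e.1 : ℕ) = e.2 + 1 ∧ m ≤ (e.2 : ℕ)}

section Flow

variable {n : ℕ} {A S T : Set (Fin n × Fin n)} {b : Fin n → ℝ} {x y g : Fin n → Fin n → ℝ}

lemma netOutflow_unitFlow (p q : Fin n) :
    netOutflow n (unitFlow p q) = Pi.single p 1 - Pi.single q 1 := by
  ext i
  simp only [netOutflow, unitFlow, LinearMap.coe_mk, AddHom.coe_mk, Pi.sub_apply,
    Pi.single_apply]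
  congr 1
  · by_cases h : i = p <;> simp [h]
  · by_cases h : i = q <;> simp [h]

lemma unitFlow_self (p q : Fin n) : unitFlow p q p q = 1 := by simp [unitFlow]

lemma unitFlow_of_ne {p q i j : Fin n} (h : (i, j) ≠ (p, q)) : unitFlow p q i j = 0 := by
  simp only [unitFlow, ite_eq_right_iff]
  rintro ⟨rfl, rfl⟩
  exact absurd rfl h

lemma unitFlow_nonneg (p q i j : Fin n) : 0 ≤ unitFlow p q i j := by
  unfold unitFlow
  split_ifs <;> norm_num

lemma supportedOn_unitFlow {p q : Fin n} (h : (p, q) ∈ S) : SupportedOn S (unitFlow p q) :=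
  fun _ _ hij => unitFlow_of_ne fun e => hij (e ▸ h)

lemma sum_mul_netOutflow (φ : Fin n → ℝ) (g : Fin n → Fin n → ℝ) :
    ∑ i, φ i * netOutflow n g i = ∑ i, ∑ j, g i j * (φ i - φ j) := by
  simp only [netOutflow, LinearMap.coe_mk, AddHom.coe_mk, mul_sub, Finset.sum_sub_distrib,
    Finset.mul_sum]
  congr 1
  · simp only [mul_comm]
  · rw [Finset.sum_comm]
    simp only [mul_comm]

namespace SupportedOn

lemma mono (h : SupportedOn S x) (hST : S ⊆ T) : SupportedOn T x :=
  fun i j hij => h i j fun hS => hij (hST hS)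

lemma add (hx : SupportedOn S x) (hy : SupportedOn S y) : SupportedOn S (x + y) :=
  fun i j hij => by simp [hx i j hij, hy i j hij]

lemma sub (hx : SupportedOn S x) (hy : SupportedOn S y) : SupportedOn S (x - y) :=
  fun i j hij => by simp [hx i j hij, hy i j hij]

lemma smul (c : ℝ) (hx : SupportedOn S x) : SupportedOn S (c • x) :=
  fun i j hij => by simp [hx i j hij]

lemma of_insert {p q : Fin n} (h : SupportedOn (insert (p, q) S) x) (hpq : x p q = 0) :
    SupportedOn S x := by
  intro i j hij
  by_cases e : (i, j) = (p, q)
  · obtain ⟨rfl, rfl⟩ := Prod.mk.inj e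
    exact hpq
  · exact h i j (by simpa [e] using hij)

end SupportedOn

lemma mem_flowPolytope_iff :
    x ∈ flowPolytope n A b ↔ (∀ i j, 0 ≤ x i j) ∧ SupportedOn A x ∧ netOutflow n x = b := by
  simp only [flowPolytope, Set.mem_ofPred_eq, SupportedOn, funext_iff, netOutflow,
    LinearMap.coe_mk, AddHom.coe_mk]

lemma convex_flowPolytope : Convex ℝ (flowPolytope n A b) := by
  intro x hx y hy s t hs ht hst
  rw [mem_flowPolytope_iff] at *
  refine ⟨fun i j => ?_, (hx.2.1.smul s).add (hy.2.1.smul t), ?_⟩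
  · have := hx.1 i j
    have := hy.1 i j
    simp only [Pi.add_apply, Pi.smul_apply, smul_eq_mul]
    positivity
  · rw [map_add, map_smul, map_smul, hx.2.2, hy.2.2, ← add_smul, hst, one_smul]

/-- An endpoint of a segment of nonnegative flows vanishes wherever an interior point does. -/
lemma SupportedOn.left_of_mem_openSegment {w : Fin n → Fin n → ℝ} (hw : SupportedOn S w)
    (hx : ∀ i j, 0 ≤ x i j) (hy : ∀ i j, 0 ≤ y i j) (h : w ∈ openSegment ℝ x y) :
    SupportedOn S x := by
  obtain ⟨s, t, hs, ht, -, rfl⟩ := h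
  intro i j hij
  have h0 := hw i j hij
  simp only [Pi.add_apply, Pi.smul_apply, smul_eq_mul] at h0
  have h1 := hx i j
  have h2 := mul_nonneg ht.le (hy i j)
  nlinarith [mul_nonneg hs.le h1]

namespace IsForest

lemma eq_of_netOutflow_eq (hS : IsForest S) (hx : SupportedOn S x) (hy : SupportedOn S y)
    (h : netOutflow n x = netOutflow n y) : x = y :=
  sub_eq_zero.1 <| hS _ (by rw [map_sub, h, sub_self]) (hx.sub hy)

lemma mem_extremePoints (hS : IsForest S) (hx : x ∈ flowPolytope n A b)
    (hxS : SupportedOn S x) : x ∈ Set.extremePoints ℝ (flowPolytope n A b) := by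
  refine ⟨hx, fun u hu v hv huv => ?_⟩
  rw [mem_flowPolytope_iff] at hx hu hv
  exact hS.eq_of_netOutflow_eq (hxS.left_of_mem_openSegment hu.1 hv.1 huv) hxS
    (hu.2.2.trans hx.2.2.symm)

/-- Circulations on a forest plus one arc are multiples of a normalized one. -/
lemma eq_smul_of_insert {p q : Fin n} (hS : IsForest S) (hg : netOutflow n g = 0)
    (hgS : SupportedOn (insert (p, q) S) g) (hg1 : g p q = 1) (hy : netOutflow n y = 0)
    (hyS : SupportedOn (insert (p, q) S) y) : y = y p q • g := by
  refine sub_eq_zero.1 (hS _ ?_ ((hyS.sub (hgS.smul _)).of_insert ?_))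
  · rw [map_sub, map_smul, hg, hy, smul_zero, sub_zero]
  · simp [hg1]

lemma exchange {p q i j : Fin n} (hS : IsForest S) (hg : netOutflow n g = 0)
    (hgS : SupportedOn (insert (p, q) S) g) (hg1 : g p q = 1) (hij : g i j ≠ 0) :
    IsForest (insert (p, q) S \ {(i, j)}) := by
  intro y hy hyS
  have h := hS.eq_smul_of_insert hg hgS hg1 hy (hyS.mono Set.sdiff_subset)
  have h0 : y i j = 0 := hyS i j (by simp)
  rw [h, Pi.smul_apply, Pi.smul_apply, smul_eq_mul, mul_eq_zero] at h0
  rw [h, h0.resolve_right hij, zero_smul]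

end IsForest

lemma isForest_support (hx : x ∈ Set.extremePoints ℝ (flowPolytope n A b)) :
    IsForest {e : Fin n × Fin n | x e.1 e.2 ≠ 0} := by
  intro g hg hgS
  obtain ⟨hxP, hext⟩ := hx
  have hx' := mem_flowPolytope_iff.1 hxP
  have hgA : SupportedOn A g := hgS.mono fun e he => by
    by_contra h
    exact he (hx'.2.1 _ _ h)
  have key : ∀ s : ℝ, ∀ᶠ ε in nhdsWithin (0 : ℝ) (Set.Ioi 0),
      ∀ i j, 0 ≤ (x + (ε * s) • g) i j := by
    intro s
    simp only [Filter.eventually_all]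
    intro i j
    rcases (hx'.1 i j).eq_or_lt with h0 | h0
    · have : g i j = 0 := hgS i j (by simp [← h0])
      simp [this, ← h0]
    · have hc : Continuous fun ε : ℝ => (x + (ε * s) • g) i j := by
        simp only [Pi.add_apply, Pi.smul_apply, smul_eq_mul]
        fun_prop
      have ht := hc.tendsto 0
      simp only [zero_mul, zero_smul, add_zero] at ht
      exact ((ht.eventually (lt_mem_nhds h0)).mono fun _ h => h.le).filter_mono
        nhdsWithin_le_nhds
  obtain ⟨ε, ⟨h1, h2⟩, hε⟩ := (((key 1).and (key (-1))).and self_mem_nhdsWithin).exists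
  have mem : ∀ s : ℝ, (∀ i j, 0 ≤ (x + (ε * s) • g) i j) →
      x + (ε * s) • g ∈ flowPolytope n A b := fun s hs =>
    mem_flowPolytope_iff.2 ⟨hs, hx'.2.1.add (hgA.smul _), by
      rw [map_add, map_smul, hg, smul_zero, add_zero, hx'.2.2]⟩
  have h := hext (mem 1 h1) (mem (-1) h2) ⟨1 / 2, 1 / 2, by norm_num, by norm_num, by norm_num, by
    module⟩
  have h' : (ε * 1) • g = 0 := by simpa using h
  rw [mul_one] at h'
  exact (smul_eq_zero.1 h').resolve_left (ne_of_gt hε)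

/-- The pivot of a flow `x` along a circulation `g` with entering arc `(p, q)`. -/
lemma exists_pivot_s11 {p q i₀ j₀ : Fin n} (hS : IsForest S) (hSA : S ⊆ A) (hpqA : (p, q) ∈ A)
    (hpq : (p, q) ∉ S) (hx : x ∈ flowPolytope n A b) (hxS : SupportedOn S x)
    (hg : netOutflow n g = 0) (hgS : SupportedOn (insert (p, q) S) g) (hg1 : g p q = 1)
    (hneg : g i₀ j₀ < 0) :
    ∃ x' ∈ flowPolytope n A b, ∃ i j, g i j < 0 ∧
      SupportedOn (insert (p, q) S \ {(i, j)}) x' ∧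
      (x = x' ∨ PolyAdj (flowPolytope n A b) x x') := by
  have hx' := mem_flowPolytope_iff.1 hx
  obtain ⟨⟨i, j⟩, he, hmin⟩ := Finset.exists_min_image
    (Finset.univ.filter fun e : Fin n × Fin n => g e.1 e.2 < 0)
    (fun e => x e.1 e.2 / -g e.1 e.2) ⟨(i₀, j₀), by simpa using hneg⟩
  simp only [Finset.mem_filter, Finset.mem_univ, true_and] at he hmin
  have he' : 0 < -g i j := by linarith
  set t := x i j / -g i j
  have ht0 : 0 ≤ t := div_nonneg (hx'.1 i j) he'.le
  have hte : x i j + t * g i j = 0 := by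
    have : t * -g i j = x i j := div_mul_cancel₀ (x i j) he'.ne'
    linarith
  have hxI : SupportedOn (insert (p, q) S) x := hxS.mono (Set.subset_insert _ _)
  have hIA : insert (p, q) S ⊆ A := Set.insert_subset hpqA hSA
  have hyS : SupportedOn (insert (p, q) S) (x + t • g) := hxI.add (hgS.smul t)
  have hyP : x + t • g ∈ flowPolytope n A b := by
    refine mem_flowPolytope_iff.2 ⟨fun k l => ?_, hyS.mono hIA, ?_⟩
    · have h0 := hx'.1 k l
      simp only [Pi.add_apply, Pi.smul_apply, smul_eq_mul]
      rcases le_or_gt 0 (g k l) with h | h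
      · positivity
      · have := (le_div_iff₀ (by linarith)).1 (hmin (k, l) h)
        linarith
    · rw [map_add, map_smul, hg, smul_zero, add_zero, hx'.2.2]
  have hyE : SupportedOn (insert (p, q) S \ {(i, j)}) (x + t • g) := by
    intro k l hkl
    by_cases e : (k, l) = (i, j)
    · obtain ⟨rfl, rfl⟩ := Prod.mk.inj e
      simpa using hte
    · exact hyS k l fun h => hkl ⟨h, e⟩
  refine ⟨x + t • g, hyP, i, j, he, hyE, ?_⟩
  rcases ht0.eq_or_lt with h0 | h0
  · left
    simp [← h0]
  right
  refine ⟨fun h => ?_, hS.mem_extremePoints hx hxS,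
    (hS.exchange hg hgS hg1 he.ne).mem_extremePoints hyP hyE,
    ⟨convex_flowPolytope.segment_subset hx hyP, ?_⟩⟩
  · have := congrFun (congrFun h p) q
    simp only [Pi.add_apply, Pi.smul_apply, smul_eq_mul, hg1] at this
    linarith
  · intro u hu v hv w hw huv
    rw [mem_flowPolytope_iff] at hu hv
    have hwS : SupportedOn (insert (p, q) S) w := by
      obtain ⟨c, d, -, -, -, rfl⟩ := hw
      exact (hxI.smul c).add (hyS.smul d)
    have huS := hwS.left_of_mem_openSegment hu.1 hv.1 huv
    have hux := hS.eq_smul_of_insert hg hgS hg1 (y := u - x)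
      (by rw [map_sub, hu.2.2, hx'.2.2, sub_self]) (huS.sub hxI)
    simp only [Pi.sub_apply, hxS p q hpq, sub_zero] at hux
    have hst : u p q ≤ t := by
      have h1 := congrFun (congrFun hux i) j
      simp only [Pi.sub_apply, Pi.smul_apply, smul_eq_mul] at h1
      have h2 := hu.1 i j
      nlinarith
    rw [segment_eq_image']
    refine ⟨u p q / t, ⟨div_nonneg (hu.1 p q) ht0, (div_le_one h0).2 hst⟩, ?_⟩
    simp only [add_sub_cancel_left, smul_smul, div_mul_cancel₀ _ h0.ne', ← hux]
    exact add_sub_cancel x u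

lemma exists_flow_pathArcs (m d : ℕ) : ∀ i j : Fin n, (i : ℕ) = j + d → m ≤ (j : ℕ) →
    ∃ y, SupportedOn (pathArcs n m) y ∧ (∀ k l, 0 ≤ y k l) ∧
      netOutflow n y = Pi.single i 1 - Pi.single j 1 := by
  induction d with
  | zero =>
    intro i j hij _
    obtain rfl : i = j := Fin.ext hij
    exact ⟨0, fun _ _ _ => rfl, fun _ _ => le_rfl, by simp⟩
  | succ d ih =>
    intro i j hij hj
    let l : Fin n := ⟨j + 1, by omega⟩
    obtain ⟨y, hyS, hy0, hy⟩ := ih i l (by simp only [l]; omega) (by simp only [l]; omega)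
    refine ⟨y + unitFlow l j, hyS.add (supportedOn_unitFlow ⟨rfl, hj⟩),
      fun k k' => add_nonneg (hy0 _ _) (unitFlow_nonneg _ _ _ _), ?_⟩
    rw [map_add, hy, netOutflow_unitFlow]
    abel

/-- Adding the next path arc to a forest either keeps it a forest or closes a cycle that
traverses the earlier path arcs forwards. -/
lemma IsForest.insert_or_exists_circulation (hA : ∀ i j, (i, j) ∈ A → j < i) {p q : Fin n}
    (hS : IsForest S) (hSA : S ⊆ A) (hp : (p : ℕ) = q + 1) (hpS : pathArcs n p ⊆ S)
    (hpq : (p, q) ∉ S) :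
    IsForest (insert (p, q) S) ∨ ∃ g, netOutflow n g = 0 ∧
      SupportedOn (insert (p, q) S) g ∧ g p q = 1 ∧ (∃ i j, g i j < 0) ∧
      ∀ i j, (i, j) ∈ pathArcs n p → 0 ≤ g i j := by
  classical
  set O : Set (Fin n × Fin n) := {e | e ∈ S ∧ e.1 < p ∧ e.2 < p}
  set R : Set (Fin n) := {j | j < p ∧ ∃ y, SupportedOn O y ∧
    netOutflow n y = Pi.single q 1 - Pi.single j 1}
  have hqp : q < p := Fin.lt_def.2 (by omega)
  have hqR : q ∈ R := ⟨hqp, 0, fun _ _ _ => rfl, by simp⟩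
  by_cases hcross : ∃ i j, (i, j) ∈ S ∧ p ≤ i ∧ j ∈ R
  · right
    obtain ⟨i, j, hij, hi, hj, y, hyO, hy⟩ := hcross
    obtain ⟨z, hzS, hz0, hz⟩ := exists_flow_pathArcs (n := n) p (i - p) i p
      (by have := Fin.le_def.1 hi; omega) le_rfl
    have hne : (p, q) ≠ (i, j) := fun e => hpq (e ▸ hij)
    have hz_low : ∀ k l : Fin n, l < p → z k l = 0 := fun k l hl =>
      hzS k l fun h => absurd h.2 (by simpa using hl)
    have hy_high : ∀ k l : Fin n, p ≤ k → y k l = 0 := fun k l hk =>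
      hyO k l fun h => absurd h.2.1 (not_lt.2 hk)
    refine ⟨unitFlow p q + y - unitFlow i j + z, ?_, ?_, ?_, ⟨i, j, ?_⟩, ?_⟩
    · rw [map_add, map_sub, map_add, netOutflow_unitFlow, netOutflow_unitFlow, hy, hz]
      abel
    · have hsub : S ⊆ insert (p, q) S := Set.subset_insert _ _
      exact (((supportedOn_unitFlow (Set.mem_insert _ _)).add
        (hyO.mono fun e he => hsub he.1)).sub (supportedOn_unitFlow (hsub hij))).add
        (hzS.mono (hpS.trans hsub))
    · simp [unitFlow_self, unitFlow_of_ne hne, hz_low p q hqp, hy_high p q le_rfl]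
    · simp [unitFlow_self, unitFlow_of_ne hne.symm, hz_low i j hj, hy_high i j hi]
    · rintro k l ⟨hkl, hl⟩
      have hl' : p ≤ l := hl
      have hk : p ≤ k := Fin.le_def.2 (by simp only at hkl hl; omega)
      have h1 : unitFlow i j k l = 0 := unitFlow_of_ne fun e => by
        obtain ⟨rfl, rfl⟩ := Prod.mk.inj e
        exact absurd hl' (not_le.2 hj)
      simp only [Pi.add_apply, Pi.sub_apply, h1, hy_high k l hk]
      have := unitFlow_nonneg p q k l
      have := hz0 k l
      linarith
  · left
    push Not at hcross
    intro g hg hgS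
    have hclosed : ∀ i j, (i, j) ∈ S → i < p → j < p → (i ∈ R ↔ j ∈ R) := by
      intro i j hij hi hj
      have hu : SupportedOn O (unitFlow i j) := supportedOn_unitFlow ⟨hij, hi, hj⟩
      constructor
      · rintro ⟨-, y, hyO, hy⟩
        exact ⟨hj, y + unitFlow i j, hyO.add hu, by
          rw [map_add, hy, netOutflow_unitFlow]; abel⟩
      · rintro ⟨-, y, hyO, hy⟩
        exact ⟨hi, y - unitFlow i j, hyO.sub hu, by
          rw [map_sub, hy, netOutflow_unitFlow]; abel⟩
    have hsum := sum_mul_netOutflow (fun i => if i ∈ R then (1 : ℝ) else 0) g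
    have hpR : p ∉ R := fun h => lt_irrefl _ h.1
    have hterm : ∀ i j, (i, j) ≠ (p, q) →
        g i j * ((if i ∈ R then (1 : ℝ) else 0) - if j ∈ R then 1 else 0) = 0 := by
      intro i j hne
      by_cases hij : (i, j) ∈ S
      · have hji := hA i j (hSA hij)
        rcases lt_or_ge i p with hi | hi
        · simp [hclosed i j hij hi (hji.trans hi)]
        · have h1 : i ∉ R := fun h => absurd h.1 (not_lt.2 hi)
          simp [h1, hcross i j hij hi]
      · rw [hgS i j (by simpa [hne] using hij), zero_mul]
    rw [hg, Finset.sum_eq_single p (fun i _ hi => Finset.sum_eq_zero fun j _ =>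
      hterm i j fun e => hi (Prod.mk.inj e).1) (by simp),
      Finset.sum_eq_single q (fun j _ hj => hterm p j fun e => hj (Prod.mk.inj e).2)
      (by simp)] at hsum
    have h0 : g p q = 0 := by simpa [hqR, hpR] using hsum
    exact hS g hg (hgS.of_insert h0)

/-- From every vertex one reaches, in one step per path arc, a flow supported on a forest that
contains the path arcs. -/
lemma exists_path_to_pathArcs (hA : ∀ i j, (i, j) ∈ A → j < i)
    (hAp : pathArcs n 0 ⊆ A) (hx : x ∈ Set.extremePoints ℝ (flowPolytope n A b)) (d m : ℕ)
    (hm : n = m + 1 + d) :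
    ∃ x' ∈ flowPolytope n A b, ∃ S ⊆ A, IsForest S ∧ SupportedOn S x' ∧ pathArcs n m ⊆ S ∧
      ∃ L ≤ d, HasPathOfLength (flowPolytope n A b) x x' L := by
  induction d generalizing m with
  | zero =>
    refine ⟨x, hx.1, _, ?_, isForest_support hx, fun i j h => by simpa using h, ?_, 0, le_rfl,
      fun _ => x, rfl, rfl, by simp⟩
    · intro e he
      by_contra h
      exact he ((mem_flowPolytope_iff.1 hx.1).2.1 _ _ h)
    · rintro ⟨i, j⟩ ⟨h1, h2⟩
      simp only at h1 h2
      omega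
  | succ d ih =>
    obtain ⟨x', hx', S, hSA, hS, hxS, hpS, L, hL, f, hf0, hfL, hf⟩ := ih (m + 1) (by omega)
    let p : Fin n := ⟨m + 1, by omega⟩
    let q : Fin n := ⟨m, by omega⟩
    have hpath : pathArcs n m ⊆ insert (p, q) (pathArcs n (m + 1)) := by
      rintro ⟨i, j⟩ ⟨h1, h2⟩
      simp only at h1 h2
      rcases h2.eq_or_lt with h | h
      · left
        ext <;> simp only [p, q] <;> omega
      · exact Or.inr ⟨h1, h⟩
    have hpqA : (p, q) ∈ A := hAp ⟨rfl, Nat.zero_le _⟩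
    have stay : ∃ L ≤ d + 1, HasPathOfLength (flowPolytope n A b) x x' L :=
      ⟨L, by omega, f, hf0, hfL, hf⟩
    by_cases hpq : (p, q) ∈ S
    · exact ⟨x', hx', S, hSA, hS, hxS, hpath.trans (Set.insert_subset hpq hpS), stay⟩
    rcases hS.insert_or_exists_circulation hA hSA (p := p) (q := q) rfl hpS hpq with
      hF | ⟨g, hg, hgS, hg1, ⟨i₀, j₀, hneg⟩, hpos⟩
    · exact ⟨x', hx', _, Set.insert_subset hpqA hSA, hF, hxS.mono (Set.subset_insert _ _),
        hpath.trans (Set.insert_subset_insert hpS), stay⟩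
    obtain ⟨y, hy, i, j, hij, hyS, hadj⟩ :=
      exists_pivot_s11 hS hSA hpqA hpq hx' hxS hg hgS hg1 hneg
    refine ⟨y, hy, _, Set.sdiff_subset.trans (Set.insert_subset hpqA hSA),
      hS.exchange hg hgS hg1 hij.ne, hyS, fun e he => ⟨?_, ?_⟩, ?_⟩
    · exact Set.insert_subset_insert hpS (hpath he)
    · rintro rfl
      rcases hpath he with h | h
      · obtain ⟨rfl, rfl⟩ := Prod.mk.inj h
        linarith
      · exact absurd (hpos i j h) (not_le.2 hij)
    · rcases hadj with rfl | hadj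
      · exact stay
      · refine ⟨L + 1, by omega, fun k => if k ≤ L then f k else y, by simpa using hf0,
          by simp, fun k hk => ?_⟩
        rcases (Nat.lt_succ_iff.1 hk).eq_or_lt with rfl | h
        · simpa [hfL] using hadj
        · simpa [h.le, Nat.succ_le_of_lt h] using hf k h

lemma IsForest.subset_pathArcs (hA : ∀ i j, (i, j) ∈ A → j < i) (hS : IsForest S)
    (hSA : S ⊆ A) (hpS : pathArcs n 0 ⊆ S) : S ⊆ pathArcs n 0 := by
  rintro ⟨i, j⟩ hij
  by_contra h
  have hji := Fin.lt_def.1 (hA i j (hSA hij))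
  obtain ⟨y, hyS, -, hy⟩ := exists_flow_pathArcs (n := n) 0 (i - j) i j (by omega) (by omega)
  have h1 := hS.eq_of_netOutflow_eq (hyS.mono hpS) (supportedOn_unitFlow hij)
    (hy.trans (netOutflow_unitFlow i j).symm)
  have h2 := hyS i j h
  rw [h1, unitFlow_self] at h2
  exact one_ne_zero h2

end Flow

lemma PolyAdj.symm {E : Type*} [AddCommGroup E] [Module ℝ E] {P : Set E} {a b : E}
    (h : PolyAdj P a b) : PolyAdj P b a :=
  ⟨h.1.symm, h.2.2.1, h.2.1, segment_symm ℝ a b ▸ h.2.2.2⟩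

lemma HasPathOfLength.symm {E : Type*} [AddCommGroup E] [Module ℝ E] {P : Set E} {a b : E}
    {L : ℕ} (h : HasPathOfLength P a b L) : HasPathOfLength P b a L := by
  obtain ⟨f, h0, hL, hf⟩ := h
  refine ⟨fun i => f (L - i), by simpa using hL, by simpa using h0, fun i hi => ?_⟩
  have h := (hf (L - (i + 1)) (by omega)).symm
  rwa [show L - (i + 1) + 1 = L - i by omega] at h

lemma HasPathOfLength.trans {E : Type*} [AddCommGroup E] [Module ℝ E] {P : Set E} {a b c : E}
    {L M : ℕ} (h : HasPathOfLength P a b L) (h' : HasPathOfLength P b c M) :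
    HasPathOfLength P a c (L + M) := by
  obtain ⟨f, hf0, hfL, hf⟩ := h
  obtain ⟨g, hg0, hgM, hg⟩ := h'
  refine ⟨fun i => if i < L then f i else g (i - L), ?_, by simpa using hgM, fun i hi => ?_⟩
  · rcases Nat.eq_zero_or_pos L with rfl | h
    · simpa [hg0, ← hfL] using hf0
    · simpa [h] using hf0
  · rcases lt_trichotomy (i + 1) L with h | h | h
    · simpa [h, (Nat.lt_succ_self i).trans h] using hf i (by omega)
    · have := hf i (by omega)
      rw [h, hfL, ← hg0] at this
      simpa [h, show i < L by omega] using this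
    · have := hg (i - L) (by omega)
      rw [show i - L + 1 = i + 1 - L by omega] at this
      simpa [show ¬ i < L by omega, show ¬ i + 1 < L by omega] using this

lemma pathArcs_subset_gnkArcs {n k : ℕ} (hk : 1 ≤ k) : pathArcs n 0 ⊆ gnkArcs n k := by
  rintro ⟨i, j⟩ ⟨h, -⟩
  simp only at h
  simp only [gnkArcs, Set.mem_ofPred_eq]
  omega

lemma pred_le_ncard_gnkArcs {n k : ℕ} (hk : 1 ≤ k) : n - 1 ≤ (gnkArcs n k).ncard := by
  let f : Fin (n - 1) → Fin n × Fin n := fun i => (⟨i + 1, by omega⟩, ⟨i, by omega⟩)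
  have hf : Function.Injective f := fun i j h => by
    simpa [f, Fin.ext_iff] using h
  calc n - 1 = (Set.range f).ncard := by
        rw [← Nat.card_coe_set_eq, Nat.card_range_of_injective hf, Nat.card_fin]
    _ ≤ (gnkArcs n k).ncard := Set.ncard_le_ncard (by
        rintro _ ⟨i, rfl⟩
        exact pathArcs_subset_gnkArcs hk ⟨rfl, Nat.zero_le _⟩) (Set.toFinite _)

/-- The diameter of the singly-capacitated network flow polytope of `G_{n,k}` is at most
twice the number of arcs. -/
theorem flowPolytope_gnk_diameter_le
    (n k : ℕ) (hn : 2 ≤ n) (hk : 1 ≤ k) (hkn : k < n) (b : Fin n → ℝ) :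
    ∀ a ∈ Set.extremePoints ℝ (flowPolytope n (gnkArcs n k) b),
      ∀ c ∈ Set.extremePoints ℝ (flowPolytope n (gnkArcs n k) b),
        ∃ L ≤ 2 * (gnkArcs n k).ncard,
          HasPathOfLength (flowPolytope n (gnkArcs n k) b) a c L := by
  intro a ha c hc
  have hA : ∀ i j, (i, j) ∈ gnkArcs n k → j < i := fun i j h => by
    simp only [gnkArcs, Set.mem_ofPred_eq] at h
    exact Fin.lt_def.2 (by omega)
  have hAp := pathArcs_subset_gnkArcs (n := n) hk
  obtain ⟨x, hx, S, hSA, hS, hxS, hpS, L, hL, hpath⟩ :=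
    exists_path_to_pathArcs hA hAp ha (n - 1) 0 (by omega)
  obtain ⟨y, hy, T, hTA, hT, hyT, hpT, M, hM, hpath'⟩ :=
    exists_path_to_pathArcs hA hAp hc (n - 1) 0 (by omega)
  have hxy : x = y := hS.eq_of_netOutflow_eq hxS
    (hyT.mono ((hT.subset_pathArcs hA hTA hpT).trans hpS))
    ((mem_flowPolytope_iff.1 hx).2.2.trans (mem_flowPolytope_iff.1 hy).2.2.symm)
  have hcard := pred_le_ncard_gnkArcs (n := n) hk
  exact ⟨L + M, by omega, hpath.trans (hxy ▸ hpath'.symm)⟩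
end
end
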